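/- arXiv:2307.15935 — 4 statements merged into one kernel-verified Lean document; each statement's English description precedes it below -/
import Mathlib

section
/- Let n ≥ 1 be an integer and z > 0 a real number, and let L be the differential operator acting on smooth functions on (0,∞) by (L f)(q) = −z · q · f′(q). Then the mirror oscillatory integral of ℙⁿ satisfies the quantum differential (GKZ) equation of ℙⁿ: applying L exactly (n+1) times to F_{n,z} gives (L^{∘(n+1)} F_{n,z})(q) = q · F_{n,z}(q) for every q > 0. (Equivalently, ((z q ∂_q)^{n+1} − q) ∫_Γ e^{W_q/z} Ω₀ = 0 for the thimble Γ = (ℝ_{>0})ⁿ, after replacing z by −z.) -/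
open MeasureTheory

/-- Givental's mirror oscillatory integral of `ℙⁿ` over the positive real thimble. -/
noncomputable def mirrorOscIntegral (n : ℕ) (z q : ℝ) : ℝ :=
  ∫ x in Set.univ.pi fun _ : Fin n => Set.Ioi (0 : ℝ),
    Real.exp (-(∑ i, x i + q / ∏ i, x i) / z) / ∏ i, x i

/-- The operator `L f = −z q f′(q)`. -/
noncomputable def mirrorOp (z : ℝ) (f : ℝ → ℝ) : ℝ → ℝ :=
  fun q => -z * q * deriv f q

open Set Filter Topology

/-- Multiplicative convolution of `f` with `t ↦ exp (-t / z)`. -/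
noncomputable def expConv (z : ℝ) (f : ℝ → ℝ) (q : ℝ) : ℝ :=
  ∫ t in Ioi (0 : ℝ), Real.exp (-t / z) * (f (q / t) / t)

/-- All iterates of `f` under `mirrorOp z` are differentiable and `O(1/s)` on `(0, ∞)`. -/
def IsMirrorRegular (z : ℝ) (f : ℝ → ℝ) : Prop :=
  ∀ k : ℕ, DifferentiableOn ℝ ((mirrorOp z)^[k] f) (Ioi 0) ∧
    ∃ C : ℝ, ∀ s : ℝ, 0 < s → |s * (mirrorOp z)^[k] f s| ≤ C

lemma mirrorOp_eqOn {z : ℝ} {f g : ℝ → ℝ} (h : EqOn f g (Ioi 0)) :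
    EqOn (mirrorOp z f) (mirrorOp z g) (Ioi 0) := by
  intro q hq
  have : f =ᶠ[𝓝 q] g := h.eventuallyEq_of_mem (Ioi_mem_nhds hq)
  simp only [mirrorOp, this.deriv_eq]

lemma iterate_mirrorOp_eqOn {z : ℝ} {f g : ℝ → ℝ} (h : EqOn f g (Ioi 0)) (k : ℕ) :
    EqOn ((mirrorOp z)^[k] f) ((mirrorOp z)^[k] g) (Ioi 0) := by
  induction k with
  | zero => exact h
  | succ k ih =>
    simp only [Function.iterate_succ_apply']
    exact mirrorOp_eqOn ih

lemma IsMirrorRegular.congr {z : ℝ} {f g : ℝ → ℝ} (hf : IsMirrorRegular z f)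
    (h : EqOn g f (Ioi 0)) : IsMirrorRegular z g := by
  intro k
  obtain ⟨hd, C, hC⟩ := hf k
  have hk := iterate_mirrorOp_eqOn (z := z) h k
  exact ⟨hd.congr hk, C, fun s hs => by rw [hk hs]; exact hC s hs⟩

lemma IsMirrorRegular.mirrorOp {z : ℝ} {f : ℝ → ℝ} (hf : IsMirrorRegular z f) :
    IsMirrorRegular z (mirrorOp z f) :=
  fun k => hf (k + 1)

lemma IsMirrorRegular.iterate {z : ℝ} {f : ℝ → ℝ} (hf : IsMirrorRegular z f) (j : ℕ) :
    IsMirrorRegular z ((_root_.mirrorOp z)^[j] f) := by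
  induction j with
  | zero => exact hf
  | succ j ih => rw [Function.iterate_succ_apply']; exact ih.mirrorOp

section bounds

variable {z C : ℝ} {g : ℝ → ℝ}

lemma integrableOn_exp_neg_div (hz : 0 < z) :
    IntegrableOn (fun t : ℝ => Real.exp (-t / z)) (Ioi 0) := by
  have := exp_neg_integrableOn_Ioi 0 (inv_pos.2 hz)
  refine this.congr_fun (fun t _ => ?_) measurableSet_Ioi
  simp only
  congr 1
  ring

lemma integrableOn_mul_exp_neg_div (hz : 0 < z) :
    IntegrableOn (fun t : ℝ => t * Real.exp (-t / z)) (Ioi 0) := by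
  have := integrableOn_rpow_mul_exp_neg_mul_rpow (p := 1) (s := 1) (by norm_num) one_pos
    (inv_pos.2 hz)
  refine this.congr_fun (fun t _ => ?_) measurableSet_Ioi
  simp only [Real.rpow_one]
  congr 2
  ring

lemma abs_comp_div_le (hC : ∀ s : ℝ, 0 < s → |s * g s| ≤ C) {q t : ℝ} (hq : 0 < q)
    (ht : 0 < t) : |g (q / t)| ≤ C / q * t := by
  have h := hC (q / t) (by positivity)
  rw [abs_mul, abs_of_pos (show 0 < q / t by positivity)] at h
  rw [div_mul_eq_mul_div, le_div_iff₀ hq]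
  rw [div_mul_eq_mul_div, div_le_iff₀ ht] at h
  linarith

lemma continuousOn_comp_div (hg : ContinuousOn g (Ioi 0)) {q : ℝ} (hq : 0 < q) :
    ContinuousOn (fun t : ℝ => g (q / t)) (Ioi 0) :=
  hg.comp (continuousOn_const.div continuousOn_id fun _ ht => (ne_of_gt ht))
    fun _ ht => div_pos hq ht

lemma integrableOn_exp_mul_comp_div (hz : 0 < z) (hg : ContinuousOn g (Ioi 0))
    (hC : ∀ s : ℝ, 0 < s → |s * g s| ≤ C) {q : ℝ} (hq : 0 < q) :
    IntegrableOn (fun t : ℝ => Real.exp (-t / z) * g (q / t)) (Ioi 0) := by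
  refine Integrable.mono' ((integrableOn_mul_exp_neg_div hz).const_mul (C / q)) ?_ ?_
  · exact ((by fun_prop : Continuous fun t : ℝ => Real.exp (-t / z)).continuousOn.mul
      (continuousOn_comp_div hg hq)).aestronglyMeasurable measurableSet_Ioi
  · refine (ae_restrict_mem measurableSet_Ioi).mono fun t ht => ?_
    rw [norm_mul, Real.norm_eq_abs, Real.norm_eq_abs, Real.abs_exp]
    have := mul_le_mul_of_nonneg_left (abs_comp_div_le hC hq ht) (Real.exp_pos (-t / z)).le
    linarith

lemma integrableOn_exp_mul_comp_div_div (hz : 0 < z) (hg : ContinuousOn g (Ioi 0))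
    (hC : ∀ s : ℝ, 0 < s → |s * g s| ≤ C) {q : ℝ} (hq : 0 < q) :
    IntegrableOn (fun t : ℝ => Real.exp (-t / z) * (g (q / t) / t)) (Ioi 0) := by
  refine Integrable.mono' ((integrableOn_exp_neg_div hz).const_mul (C / q)) ?_ ?_
  · exact ((by fun_prop : Continuous fun t : ℝ => Real.exp (-t / z)).continuousOn.mul
      ((continuousOn_comp_div hg hq).div continuousOn_id fun _ ht => ne_of_gt ht)
      ).aestronglyMeasurable measurableSet_Ioi
  · refine (ae_restrict_mem measurableSet_Ioi).mono fun t (ht : 0 < t) => ?_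
    rw [norm_mul, norm_div, Real.norm_eq_abs, Real.norm_eq_abs, Real.norm_eq_abs, Real.abs_exp,
      abs_of_pos ht, mul_comm]
    refine mul_le_mul_of_nonneg_right ?_ (Real.exp_pos _).le
    rw [div_le_iff₀ ht]
    exact abs_comp_div_le hC hq ht

lemma abs_mul_expConv_le (hz : 0 < z) (hC : ∀ s : ℝ, 0 < s → |s * g s| ≤ C) {q : ℝ}
    (hq : 0 < q) : |q * expConv z g q| ≤ C * ∫ t in Ioi (0 : ℝ), Real.exp (-t / z) := by
  have h : ‖expConv z g q‖ ≤ ∫ t in Ioi (0 : ℝ), C / q * Real.exp (-t / z) := by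
    refine norm_integral_le_of_norm_le ((integrableOn_exp_neg_div hz).const_mul _) ?_
    refine (ae_restrict_mem measurableSet_Ioi).mono fun t (ht : 0 < t) => ?_
    rw [norm_mul, norm_div, Real.norm_eq_abs, Real.norm_eq_abs, Real.norm_eq_abs, Real.abs_exp,
      abs_of_pos ht, mul_comm]
    refine mul_le_mul_of_nonneg_right ?_ (Real.exp_pos _).le
    rw [div_le_iff₀ ht]
    exact abs_comp_div_le hC hq ht
  rw [integral_const_mul, Real.norm_eq_abs, div_mul_eq_mul_div, le_div_iff₀ hq] at h
  rw [abs_mul, abs_of_pos hq]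
  linarith

lemma expConv_eq_laplace {q : ℝ} (hq : 0 < q) :
    expConv z g q = ∫ u in Ioi (0 : ℝ), Real.exp (-(q * u) / z) * (g (1 / u) / u) := by
  have h := integral_comp_mul_left_Ioi
    (fun t : ℝ => Real.exp (-t / z) * (g (q / t) / t)) 0 hq
  rw [mul_zero, eq_inv_smul_iff₀ hq.ne', smul_eq_mul, ← integral_const_mul] at h
  rw [expConv, ← h]
  refine setIntegral_congr_fun measurableSet_Ioi fun u (hu : 0 < u) => ?_
  have : q / (q * u) = 1 / u := by field_simp
  simp only [this]
  field_simp

lemma hasDerivAt_expConv (hz : 0 < z) (hg : ContinuousOn g (Ioi 0))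
    (hC : ∀ s : ℝ, 0 < s → |s * g s| ≤ C) {q : ℝ} (hq : 0 < q) :
    HasDerivAt (expConv z g)
      (∫ u in Ioi (0 : ℝ), -(1 / z) * (Real.exp (-(q * u) / z) * g (1 / u))) q := by
  have hg1 := continuousOn_comp_div hg one_pos
  have hexp (p : ℝ) : Continuous fun u : ℝ => Real.exp (-(p * u) / z) := by fun_prop
  have hmeas (p : ℝ) : AEStronglyMeasurable
      (fun u : ℝ => Real.exp (-(p * u) / z) * (g (1 / u) / u)) (volume.restrict (Ioi 0)) :=
    ((hexp p).continuousOn.mul (hg1.div continuousOn_id fun _ ht => ne_of_gt ht)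
      ).aestronglyMeasurable measurableSet_Ioi
  have hz' (p : ℝ) (hp : 0 < p) (u : ℝ) : Real.exp (-(p * u) / z) = Real.exp (-u / (z / p)) := by
    congr 1
    field_simp
  have key := hasDerivAt_integral_of_dominated_loc_of_deriv_le (μ := volume.restrict (Ioi 0))
    (F := fun p u : ℝ => Real.exp (-(p * u) / z) * (g (1 / u) / u))
    (F' := fun p u : ℝ => -(1 / z) * (Real.exp (-(p * u) / z) * g (1 / u)))
    (x₀ := q) (s := Ioi (q / 2)) (bound := fun u => C / z * (u * Real.exp (-u / (z / (q / 2)))))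
    (Ioi_mem_nhds (by linarith)) (Eventually.of_forall hmeas) ?_ ?_ ?_ ?_ ?_
  · refine key.2.congr_of_eventuallyEq ?_
    filter_upwards [Ioi_mem_nhds hq] with p hp using expConv_eq_laplace hp
  · simp only [hz' q hq]
    exact integrableOn_exp_mul_comp_div_div (by positivity) hg hC one_pos
  · exact (continuousOn_const.mul ((hexp q).continuousOn.mul hg1)).aestronglyMeasurable
      measurableSet_Ioi
  · refine (ae_restrict_mem measurableSet_Ioi).mono fun u (hu : 0 < u) p (hp : q / 2 < p) => ?_
    have h1 := abs_comp_div_le hC one_pos hu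
    have h2 : Real.exp (-(p * u) / z) ≤ Real.exp (-u / (z / (q / 2))) := by
      rw [← hz' (q / 2) (by linarith)]
      gcongr
    rw [norm_mul, norm_mul, norm_neg, Real.norm_eq_abs, Real.norm_eq_abs, Real.norm_eq_abs,
      Real.abs_exp, abs_of_pos (by positivity)]
    calc 1 / z * (Real.exp (-(p * u) / z) * |g (1 / u)|)
        ≤ 1 / z * (Real.exp (-u / (z / (q / 2))) * (C / 1 * u)) := by gcongr
      _ = _ := by ring
  · exact (integrableOn_mul_exp_neg_div (by positivity)).const_mul _
  · refine (ae_restrict_mem measurableSet_Ioi).mono fun u (hu : 0 < u) p _ => ?_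
    have h : HasDerivAt (fun p : ℝ => -(p * u) / z) (-(1 * u) / z) p :=
      (((hasDerivAt_id p).mul_const u).neg).div_const z
    refine (h.exp.mul_const (g (1 / u) / u)).congr_deriv ?_
    field_simp

lemma mirrorOp_expConv (hz : 0 < z) (hg : ContinuousOn g (Ioi 0))
    (hC : ∀ s : ℝ, 0 < s → |s * g s| ≤ C) {q : ℝ} (hq : 0 < q) :
    mirrorOp z (expConv z g) q = ∫ t in Ioi (0 : ℝ), Real.exp (-t / z) * g (q / t) := by
  have h := integral_comp_mul_left_Ioi
    (fun t : ℝ => Real.exp (-t / z) * g (q / t)) 0 hq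
  rw [mul_zero, eq_inv_smul_iff₀ hq.ne', smul_eq_mul] at h
  rw [mirrorOp, (hasDerivAt_expConv hz hg hC hq).deriv, ← h, integral_const_mul, ← mul_assoc]
  congr 1
  · field_simp
  · refine setIntegral_congr_fun measurableSet_Ioi fun u (hu : 0 < u) => ?_
    have : q / (q * u) = 1 / u := by field_simp
    simp only [this]

end bounds

lemma expConv_mirrorOp {z C C' : ℝ} {g : ℝ → ℝ} (hz : 0 < z)
    (hg : DifferentiableOn ℝ g (Ioi 0)) (hC : ∀ s : ℝ, 0 < s → |s * g s| ≤ C)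
    (hLg : ContinuousOn (mirrorOp z g) (Ioi 0))
    (hC' : ∀ s : ℝ, 0 < s → |s * mirrorOp z g s| ≤ C') {q : ℝ} (hq : 0 < q) :
    expConv z (mirrorOp z g) q = ∫ t in Ioi (0 : ℝ), Real.exp (-t / z) * g (q / t) := by
  have hv' (t : ℝ) (ht : 0 < t) :
      mirrorOp z g (q / t) / t = z * (deriv g (q / t) * (-q / t ^ 2)) := by
    simp only [mirrorOp]
    field_simp
  have hint := integrableOn_exp_mul_comp_div hz hg.continuousOn hC hq
  have hlim : Tendsto (fun t : ℝ => C / q * (t * Real.exp (-t / z))) (𝓝 0) (𝓝 0) := by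
    have : Continuous fun t : ℝ => C / q * (t * Real.exp (-t / z)) := by fun_prop
    simpa using this.tendsto 0
  have hlim' : Tendsto (fun t : ℝ => C / q * (t * Real.exp (-t / z))) atTop (𝓝 0) := by
    have h := (Real.tendsto_pow_mul_exp_neg_atTop_nhds_zero 1).comp
      (tendsto_id.atTop_div_const hz)
    simpa using (h.const_mul (C / q * z)).congr fun t => by
      simp only [Function.comp_apply, id, neg_div]
      field_simp
  have hle (t : ℝ) (ht : 0 < t) :
      ‖Real.exp (-t / z) * g (q / t)‖ ≤ C / q * (t * Real.exp (-t / z)) := by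
    rw [norm_mul, Real.norm_eq_abs, Real.norm_eq_abs, Real.abs_exp]
    have := mul_le_mul_of_nonneg_left (abs_comp_div_le hC hq ht) (Real.exp_pos (-t / z)).le
    linarith
  have key := integral_Ioi_mul_deriv_eq_deriv_mul (a := 0) (a' := 0) (b' := 0)
    (u := fun t : ℝ => Real.exp (-t / z)) (u' := fun t => Real.exp (-t / z) * (-1 / z))
    (v := fun t => g (q / t)) (v' := fun t => deriv g (q / t) * (-q / t ^ 2))
    (fun t _ => ((hasDerivAt_id t).neg.div_const z).exp) ?_ ?_ ?_ ?_ ?_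
  · have h1 : expConv z (mirrorOp z g) q
        = z * ∫ t in Ioi (0 : ℝ), Real.exp (-t / z) * (deriv g (q / t) * (-q / t ^ 2)) := by
      rw [expConv, ← integral_const_mul]
      refine setIntegral_congr_fun measurableSet_Ioi fun t ht => ?_
      simp only [hv' t ht]
      ring
    have h2 : ∫ t in Ioi (0 : ℝ), Real.exp (-t / z) * (-1 / z) * g (q / t)
        = (-1 / z) * ∫ t in Ioi (0 : ℝ), Real.exp (-t / z) * g (q / t) := by
      rw [← integral_const_mul]
      congr 1 with t
      ring
    rw [h1, key, h2]
    field_simp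
    ring
  · intro t ht
    have hgt := (hg.differentiableAt (Ioi_mem_nhds (div_pos hq ht))).hasDerivAt
    have hdiv : HasDerivAt (fun t : ℝ => q / t) (-q / t ^ 2) t := by
      simpa [div_eq_mul_inv] using (hasDerivAt_inv (ne_of_gt ht)).const_mul q
    exact hgt.comp t hdiv
  · have := (integrableOn_exp_mul_comp_div_div hz hLg hC' hq).const_mul (1 / z)
    refine IntegrableOn.congr_fun this (fun t ht => ?_) measurableSet_Ioi
    simp only [hv' t ht, Pi.mul_apply]
    field_simp
  · refine IntegrableOn.congr_fun (hint.const_mul (-1 / z)) (fun t ht => ?_) measurableSet_Ioi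
    simp only [Pi.mul_apply]
    ring
  · exact squeeze_zero_norm' (eventually_mem_nhdsWithin.mono hle)
      (hlim.mono_left nhdsWithin_le_nhds)
  · exact squeeze_zero_norm' ((eventually_gt_atTop 0).mono hle) hlim'

lemma IsMirrorRegular.eqOn_mirrorOp_expConv {z : ℝ} {f : ℝ → ℝ} (hz : 0 < z)
    (hf : IsMirrorRegular z f) :
    EqOn (_root_.mirrorOp z (expConv z f)) (expConv z (_root_.mirrorOp z f)) (Ioi 0) := by
  intro q hq
  obtain ⟨hd, C, hC⟩ := hf 0
  obtain ⟨hd', C', hC'⟩ := hf 1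
  exact (mirrorOp_expConv hz hd.continuousOn hC hq).trans
    (expConv_mirrorOp hz hd hC hd'.continuousOn hC' hq).symm

lemma IsMirrorRegular.eqOn_iterate_expConv {z : ℝ} {f : ℝ → ℝ} (hz : 0 < z)
    (hf : IsMirrorRegular z f) (k : ℕ) :
    EqOn ((_root_.mirrorOp z)^[k] (expConv z f)) (expConv z ((_root_.mirrorOp z)^[k] f))
      (Ioi 0) := by
  induction k with
  | zero => exact fun _ _ => rfl
  | succ k ih =>
    simp only [Function.iterate_succ_apply']
    exact (mirrorOp_eqOn ih).trans ((hf.iterate k).eqOn_mirrorOp_expConv hz)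

lemma IsMirrorRegular.expConv {z : ℝ} {f : ℝ → ℝ} (hz : 0 < z) (hf : IsMirrorRegular z f) :
    IsMirrorRegular z (expConv z f) := by
  intro k
  have hk := hf.eqOn_iterate_expConv hz k
  obtain ⟨hd, C, hC⟩ := hf k
  refine ⟨DifferentiableOn.congr (fun q hq => ?_) hk,
    C * ∫ t in Ioi (0 : ℝ), Real.exp (-t / z), fun s hs => ?_⟩
  · exact (hasDerivAt_expConv hz hd.continuousOn hC hq).differentiableAt.differentiableWithinAt
  · rw [hk hs]
    exact abs_mul_expConv_le hz hC hs

/-- If `L^m f = q f`, then `L^(m + 1)` of the convolution is `q` times the convolution. -/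
lemma IsMirrorRegular.iterate_succ_expConv {z : ℝ} {f : ℝ → ℝ} (hz : 0 < z)
    (hf : IsMirrorRegular z f) {m : ℕ}
    (hm : ∀ q : ℝ, 0 < q → (_root_.mirrorOp z)^[m] f q = q * f q) {q : ℝ} (hq : 0 < q) :
    (_root_.mirrorOp z)^[m + 1] (_root_.expConv z f) q = q * _root_.expConv z f q := by
  obtain ⟨hd, C, hC⟩ := hf m
  rw [Function.iterate_succ_apply', mirrorOp_eqOn (hf.eqOn_iterate_expConv hz m) hq,
    mirrorOp_expConv hz hd.continuousOn hC hq, _root_.expConv, ← integral_const_mul]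
  refine setIntegral_congr_fun measurableSet_Ioi fun t (ht : 0 < t) => ?_
  simp only [hm (q / t) (div_pos hq ht)]
  ring

lemma mirrorOp_polynomial_mul_exp {z : ℝ} (hz : 0 < z) (p : Polynomial ℝ) :
    mirrorOp z (fun q => p.eval q * Real.exp (-q / z)) = fun q =>
      (Polynomial.X * p - Polynomial.C z * Polynomial.X * p.derivative).eval q
        * Real.exp (-q / z) := by
  funext q
  have h : HasDerivAt (fun q => p.eval q * Real.exp (-q / z)) _ q :=
    (p.hasDerivAt q).mul ((hasDerivAt_id q).neg.div_const z).exp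
  rw [mirrorOp, h.deriv]
  simp only [id, Pi.neg_apply, Polynomial.eval_sub, Polynomial.eval_mul, Polynomial.eval_X,
    Polynomial.eval_C]
  field_simp
  ring

lemma exists_abs_polynomial_mul_exp_le {z : ℝ} (hz : 0 < z) (p : Polynomial ℝ) :
    ∃ C : ℝ, ∀ s : ℝ, 0 < s → |p.eval s * Real.exp (-s / z)| ≤ C := by
  induction p using Polynomial.induction_on' with
  | add p r hp hr =>
    obtain ⟨C, hC⟩ := hp
    obtain ⟨D, hD⟩ := hr
    refine ⟨C + D, fun s hs => ?_⟩
    rw [Polynomial.eval_add, add_mul]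
    exact (abs_add_le _ _).trans (add_le_add (hC s hs) (hD s hs))
  | monomial m a =>
    refine ⟨|a| * (z ^ m * m.factorial), fun s hs => ?_⟩
    rw [Polynomial.eval_monomial, mul_assoc, abs_mul, abs_of_pos (a := s ^ m * _) (by positivity)]
    refine mul_le_mul_of_nonneg_left ?_ (abs_nonneg a)
    have h := Real.pow_div_factorial_le_exp (s / z) (by positivity) m
    rw [neg_div, Real.exp_neg, ← div_eq_mul_inv, div_le_iff₀ (Real.exp_pos _)]
    rw [div_pow, div_div, div_le_iff₀ (by positivity)] at h
    linarith

lemma isMirrorRegular_exp {z : ℝ} (hz : 0 < z) :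
    IsMirrorRegular z fun q => Real.exp (-q / z) := by
  intro k
  obtain ⟨p, hp⟩ : ∃ p : Polynomial ℝ, (mirrorOp z)^[k] (fun q => Real.exp (-q / z))
      = fun q => p.eval q * Real.exp (-q / z) := by
    induction k with
    | zero => exact ⟨1, by simp⟩
    | succ k ih =>
      obtain ⟨p, hp⟩ := ih
      rw [Function.iterate_succ_apply', hp]
      exact ⟨_, mirrorOp_polynomial_mul_exp hz p⟩
  rw [hp]
  refine ⟨Differentiable.differentiableOn (by fun_prop), ?_⟩
  obtain ⟨C, hC⟩ := exists_abs_polynomial_mul_exp_le hz (Polynomial.X * p)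
  refine ⟨C, fun s hs => ?_⟩
  have := hC s hs
  rwa [Polynomial.eval_mul, Polynomial.eval_X, mul_assoc] at this

/-- The integrand of `mirrorOscIntegral`. -/
noncomputable def mirrorIntegrand (n : ℕ) (z q : ℝ) (x : Fin n → ℝ) : ℝ :=
  Real.exp (-(∑ i, x i + q / ∏ i, x i) / z) / ∏ i, x i

lemma measurable_mirrorIntegrand (n : ℕ) (z q : ℝ) : Measurable (mirrorIntegrand n z q) := by
  unfold mirrorIntegrand
  fun_prop

/-- The restriction of Lebesgue measure to the positive orthant. -/
noncomputable def orthantMeasure (n : ℕ) : Measure (Fin n → ℝ) :=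
  Measure.pi fun _ => volume.restrict (Ioi 0)

lemma mirrorOscIntegral_eq (n : ℕ) (z q : ℝ) :
    mirrorOscIntegral n z q = ∫ x, mirrorIntegrand n z q x ∂orthantMeasure n := by
  rw [mirrorOscIntegral, volume_pi, Measure.restrict_pi_pi]
  rfl

lemma mirrorIntegrand_cons (n : ℕ) (z q t : ℝ) (y : Fin n → ℝ) :
    mirrorIntegrand (n + 1) z q (Fin.cons t y)
      = Real.exp (-t / z) / t * mirrorIntegrand n z (q / t) y := by
  simp only [mirrorIntegrand, Fin.sum_univ_succ, Fin.prod_univ_succ, Fin.cons_zero, Fin.cons_succ]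
  rw [div_mul_div_comm, ← Real.exp_add, div_div]
  congr 2
  ring

lemma ae_orthantMeasure_pos (n : ℕ) : ∀ᵐ x ∂orthantMeasure n, ∀ i, 0 < x i := by
  rw [orthantMeasure, ← Measure.restrict_pi_pi]
  filter_upwards [ae_restrict_mem (MeasurableSet.univ_pi fun _ => measurableSet_Ioi)] with x hx i
  exact hx i (mem_univ i)

lemma mirrorIntegrand_nonneg_ae (n : ℕ) (z q : ℝ) :
    ∀ᵐ x ∂orthantMeasure n, 0 ≤ mirrorIntegrand n z q x := by
  filter_upwards [ae_orthantMeasure_pos n] with x hx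
  exact div_nonneg (Real.exp_pos _).le (Finset.prod_nonneg fun i _ => (hx i).le)

lemma piFinSuccAbove_zero_symm_eq (n : ℕ) :
    ⇑(MeasurableEquiv.piFinSuccAbove (fun _ : Fin (n + 1) => ℝ) 0).symm
      = fun w : ℝ × (Fin n → ℝ) => (Fin.cons w.1 w.2 : Fin (n + 1) → ℝ) := by
  funext w
  exact Fin.insertNth_zero (α := fun _ => ℝ) w.1 w.2

lemma measurableEmbedding_cons (n : ℕ) :
    MeasurableEmbedding fun w : ℝ × (Fin n → ℝ) => (Fin.cons w.1 w.2 : Fin (n + 1) → ℝ) := by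
  rw [← piFinSuccAbove_zero_symm_eq]
  exact MeasurableEquiv.measurableEmbedding _

lemma measurePreserving_cons_orthant (n : ℕ) :
    MeasurePreserving (fun w : ℝ × (Fin n → ℝ) => (Fin.cons w.1 w.2 : Fin (n + 1) → ℝ))
      ((volume.restrict (Ioi 0)).prod (orthantMeasure n)) (orthantMeasure (n + 1)) := by
  rw [← piFinSuccAbove_zero_symm_eq]
  exact (measurePreserving_piFinSuccAbove
    (fun _ : Fin (n + 1) => volume.restrict (Ioi (0 : ℝ))) 0).symm _

instance (n : ℕ) : SigmaFinite (orthantMeasure n) := by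
  unfold orthantMeasure
  infer_instance

lemma integrable_mirrorIntegrand_prod {n : ℕ} {z q : ℝ} (hz : 0 < z) (hq : 0 < q)
    (hint : ∀ q : ℝ, 0 < q → Integrable (mirrorIntegrand n z q) (orthantMeasure n))
    (hreg : IsMirrorRegular z (mirrorOscIntegral n z)) :
    Integrable (fun w : ℝ × (Fin n → ℝ) => mirrorIntegrand (n + 1) z q (Fin.cons w.1 w.2))
      ((volume.restrict (Ioi 0)).prod (orthantMeasure n)) := by
  have hmeas : Measurable
      fun w : ℝ × (Fin n → ℝ) => mirrorIntegrand (n + 1) z q (Fin.cons w.1 w.2) :=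
    (measurable_mirrorIntegrand (n + 1) z q).comp
      (measurableEmbedding_cons n).measurable
  obtain ⟨hd, C, hC⟩ := hreg 0
  rw [integrable_prod_iff hmeas.aestronglyMeasurable]
  simp only [mirrorIntegrand_cons]
  constructor
  · filter_upwards [ae_restrict_mem measurableSet_Ioi] with t ht
    exact (hint _ (div_pos hq ht)).const_mul _
  · refine IntegrableOn.congr_fun (integrableOn_exp_mul_comp_div_div hz hd.continuousOn hC hq)
      (fun t (ht : 0 < t) => ?_) measurableSet_Ioi
    simp only [norm_mul, integral_const_mul, Function.iterate_zero, id, mirrorOscIntegral_eq]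
    rw [integral_congr_ae ((mirrorIntegrand_nonneg_ae n z (q / t)).mono
      fun x hx => Real.norm_of_nonneg hx), Real.norm_of_nonneg (by positivity)]
    ring

lemma mirrorOscIntegral_succ {n : ℕ} {z q : ℝ} (hz : 0 < z) (hq : 0 < q)
    (hint : ∀ q : ℝ, 0 < q → Integrable (mirrorIntegrand n z q) (orthantMeasure n))
    (hreg : IsMirrorRegular z (mirrorOscIntegral n z)) :
    mirrorOscIntegral (n + 1) z q = expConv z (mirrorOscIntegral n z) q := by
  rw [mirrorOscIntegral_eq, ← (measurePreserving_cons_orthant n).integral_comp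
    (measurableEmbedding_cons n)]
  refine (integral_prod _ (integrable_mirrorIntegrand_prod hz hq hint hreg)).trans ?_
  simp only [mirrorIntegrand_cons, integral_const_mul, ← mirrorOscIntegral_eq, expConv]
  congr 1 with t
  ring

lemma orthantMeasure_zero : orthantMeasure 0 = Measure.dirac default := by
  rw [orthantMeasure, Measure.pi_of_empty]
  congr 1
  exact Subsingleton.elim _ _

lemma mirrorOscIntegral_zero (z q : ℝ) : mirrorOscIntegral 0 z q = Real.exp (-q / z) := by
  rw [mirrorOscIntegral_eq, orthantMeasure_zero, integral_dirac]
  simp [mirrorIntegrand]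

lemma integrable_mirrorIntegrand_and_isMirrorRegular {z : ℝ} (hz : 0 < z) (n : ℕ) :
    (∀ q : ℝ, 0 < q → Integrable (mirrorIntegrand n z q) (orthantMeasure n)) ∧
      IsMirrorRegular z (mirrorOscIntegral n z) := by
  induction n with
  | zero =>
    refine ⟨fun q _ => ?_, (isMirrorRegular_exp hz).congr fun q _ => mirrorOscIntegral_zero z q⟩
    rw [orthantMeasure_zero]
    exact integrable_dirac (by simp)
  | succ n ih =>
    refine ⟨fun q hq => ?_, (ih.2.expConv hz).congr fun q hq =>
      mirrorOscIntegral_succ hz hq ih.1 ih.2⟩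
    rw [← (measurePreserving_cons_orthant n).integrable_comp_emb
      (measurableEmbedding_cons n)]
    exact integrable_mirrorIntegrand_prod hz hq ih.1 ih.2

/-- the mirror oscillatory integral of `ℙⁿ` satisfies the GKZ
(quantum differential) equation `(L^{∘(n+1)} F_{n,z})(q) = q · F_{n,z}(q)`
for all `q > 0`, where `(L f)(q) = −z q f′(q)`. -/
theorem mirrorOscIntegral_GKZ (n : ℕ) (hn : 1 ≤ n) (z : ℝ) (hz : 0 < z) :
    ∀ q : ℝ, 0 < q →
      (mirrorOp z)^[n + 1] (mirrorOscIntegral n z) q = q * mirrorOscIntegral n z q := by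
  clear hn
  induction n with
  | zero =>
    intro q hq
    have h : EqOn (mirrorOscIntegral 0 z) (fun q => (1 : Polynomial ℝ).eval q * Real.exp (-q / z))
        (Ioi 0) := fun q _ => by simp [mirrorOscIntegral_zero]
    rw [iterate_mirrorOp_eqOn h _ hq, zero_add, Function.iterate_one,
      mirrorOp_polynomial_mul_exp hz, mirrorOscIntegral_zero]
    simp
  | succ n ih =>
    intro q hq
    obtain ⟨hint, hreg⟩ := integrable_mirrorIntegrand_and_isMirrorRegular hz n
    have h : EqOn (mirrorOscIntegral (n + 1) z) (expConv z (mirrorOscIntegral n z)) (Ioi 0) :=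
      fun q hq => mirrorOscIntegral_succ hz hq hint hreg
    rw [iterate_mirrorOp_eqOn h _ hq, h hq]
    exact hreg.iterate_succ_expConv hz ih hq
end

section
/- Let n ≥ 1 be an integer and z > 0, q > 0 real numbers. For each integer d ≥ 0, define the entire-near-(−d) function g_d(p) = exp(−p log q) · exp((n+1) p log z) · ( Γ(p + d + 1) / Π_{j=0}^{d−1} (p + j) )^{n+1} of the complex variable p, where Γ is the complex Gamma function and the empty product (d = 0) is 1. Then the series of residues converges and F_{n,z}(q) = Σ_{d=0}^∞ (1/n!) · g_d^{(n)}(−d), where g_d^{(n)}(−d) denotes the n-th complex derivative of g_d at p = −d. (The d-th summand is the residue at p = −d of q^{−p} z^{(n+1)p} Γ(p)^{n+1}.) -/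
open MeasureTheory

/-- The function `g_d(p) = q^{−p} z^{(n+1)p} (Γ(p+d+1)/∏_{j=0}^{d−1}(p+j))^{n+1}`,
which is analytic near `p = −d`; its `n`-th derivative at `−d` divided by `n!`
is the residue of `q^{−p} z^{(n+1)p} Γ(p)^{n+1}` at `p = −d`. -/
noncomputable def residueFunction (n : ℕ) (z q : ℝ) (d : ℕ) (p : ℂ) : ℂ :=
  Complex.exp (-p * Real.log q) * Complex.exp (((n : ℂ) + 1) * p * Real.log z) *
    (Complex.Gamma (p + d + 1) / ∏ j ∈ Finset.range d, (p + j)) ^ (n + 1)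

section

open Complex Filter Topology Set
open scoped Real

theorem exists_taylor_remainder {g : ℂ → ℂ} {U : Set ℂ} (hU : U ∈ 𝓝 0)
    (hg : DifferentiableOn ℂ g U) (m : ℕ) :
    ∃ h : ℂ → ℂ, DifferentiableOn ℂ h U ∧ ∀ s, g s =
      (∑ k ∈ Finset.range m, iteratedDeriv k g 0 / (k.factorial : ℂ) * s ^ k) + s ^ m * h s := by
  have han : AnalyticAt ℂ g 0 := hg.analyticAt hU
  have hp := han.hasFPowerSeriesAt
  have hcoeff (k : ℕ) :
      (Function.swap dslope 0)^[k] g 0 = iteratedDeriv k g 0 / (k.factorial : ℂ) := by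
    rw [← (hp.has_fpower_series_iterate_dslope_fslope k).coeff_zero 1]
    change (FormalMultilinearSeries.fslope^[k] _).coeff 0 = _
    simp [FormalMultilinearSeries.coeff_iterate_fslope, FormalMultilinearSeries.coeff_ofScalars]
  refine ⟨(Function.swap dslope 0)^[m] g, ?_, ?_⟩
  · induction m with
    | zero => exact hg
    | succ m ih =>
      rw [Function.iterate_succ_apply']
      exact (Complex.differentiableOn_dslope hU).2 ih
  · induction m with
    | zero => intro s; simp
    | succ m ih =>
      intro s
      rw [ih s, Finset.sum_range_succ, Function.iterate_succ_apply', ← hcoeff m]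
      have := sub_smul_dslope ((Function.swap dslope 0)^[m] g) 0 s
      simp only [sub_zero, smul_eq_mul] at this
      change _ = _ + s ^ (m + 1) * dslope _ 0 s
      linear_combination -s ^ m * this

theorem isOpen_strip : IsOpen {s : ℂ | |s.re| < 1} :=
  isOpen_lt (by fun_prop) continuous_const

theorem tendsto_integral_line_sub_line_of_differentiableOn {h : ℂ → ℂ} {C : ℝ}
    (hd : DifferentiableOn ℂ h {s : ℂ | |s.re| < 1})
    (hC : ∀ s : ℂ, |s.re| ≤ 1 / 2 → 1 ≤ |s.im| → ‖h s‖ ≤ C / |s.im|) :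
    Tendsto (fun T : ℝ => ∫ t in (-T)..T,
      (h ((1 / 2 : ℝ) + t * I) - h ((-(1 / 2) : ℝ) + t * I))) atTop (𝓝 0) := by
  have hcont (a : ℝ) (ha : |a| < 1) : Continuous fun t : ℝ => h (a + t * I) := by
    refine hd.continuousOn.comp_continuous (by fun_prop) fun t => ?_
    simpa using ha
  have hbound : ∀ T : ℝ, 1 ≤ T → ‖∫ t in (-T)..T,
      (h ((1 / 2 : ℝ) + t * I) - h ((-(1 / 2) : ℝ) + t * I))‖ ≤ 2 * C / T := by
    intro T hT
    have hrect := integral_boundary_rect_eq_zero_of_differentiableOn h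
      (⟨-(1 / 2), -T⟩ : ℂ) (⟨1 / 2, T⟩ : ℂ) (hd.mono fun s hs => by
        have h1 := hs.1
        simp only [mem_preimage] at h1
        rw [uIcc_of_le (by norm_num)] at h1
        simp only [mem_ofPred_eq, abs_lt]
        constructor <;> linarith [h1.1, h1.2])
    simp only [smul_eq_mul] at hrect
    rw [intervalIntegral.integral_sub
      ((hcont _ (by norm_num [abs_of_pos])).intervalIntegrable _ _)
      ((hcont _ (by norm_num [abs_of_pos])).intervalIntegrable _ _)]
    have hside (c : ℝ) (hc : |c| = T) :
        ‖∫ x in (-(1 / 2) : ℝ)..(1 / 2), h (x + c * I)‖ ≤ C / T := by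
      refine (intervalIntegral.norm_integral_le_of_norm_le_const (C := C / T) fun x hx => ?_).trans
        (by norm_num)
      rw [uIoc_of_le (by norm_num)] at hx
      refine (hC _ ?_ ?_).trans_eq ?_
      · simp only [add_re, ofReal_re, mul_re, I_re, ofReal_im, I_im]
        rw [abs_le]
        constructor <;> linarith [hx.1, hx.2]
      · simpa [hc] using hT
      · simp [hc]
    have h1 := hside T (abs_of_pos (by linarith))
    have h2 := hside (-T) (by rw [abs_neg]; exact abs_of_pos (by linarith))
    have heq : (∫ t in (-T)..T, h ((1 / 2 : ℝ) + t * I)) -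
        (∫ t in (-T)..T, h ((-(1 / 2) : ℝ) + t * I)) =
        I * ((∫ x in (-(1 / 2) : ℝ)..(1 / 2), h (x + (-T : ℝ) * I)) -
          ∫ x in (-(1 / 2) : ℝ)..(1 / 2), h (x + T * I)) := by
      linear_combination (-I) * hrect + ((∫ t in (-T)..T, h ((1 / 2 : ℝ) + t * I)) -
        (∫ t in (-T)..T, h ((-(1 / 2) : ℝ) + t * I))) * I_mul_I
    rw [heq, norm_mul, norm_I, one_mul]
    refine (norm_sub_le _ _).trans ?_
    rw [mul_div_assoc]
    linarith
  refine squeeze_zero_norm' (a := fun T => 2 * C / T) ?_ ?_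
  · filter_upwards [eventually_ge_atTop 1] with T hT using hbound T hT
  · exact tendsto_const_nhds.div_atTop tendsto_id

theorem line_ne_zero {a : ℝ} (ha : a ≠ 0) (t : ℝ) : (a + t * I : ℂ) ≠ 0 := fun h => ha (by
  simpa using congrArg re h)

theorem continuous_inv_pow_line {a : ℝ} (ha : a ≠ 0) (m : ℕ) :
    Continuous fun t : ℝ => ((a + t * I : ℂ) ^ m)⁻¹ :=
  Continuous.inv₀ (by fun_prop) fun t => pow_ne_zero _ (line_ne_zero ha t)

theorem tendsto_integral_inv_pow_line {a : ℝ} (ha : a ≠ 0) {m : ℕ} (hm : m ≠ 0) :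
    Tendsto (fun T : ℝ => ∫ t in (-T)..T, ((a + t * I : ℂ) ^ (m + 1))⁻¹) atTop (𝓝 0) := by
  have hderiv (t : ℝ) : HasDerivAt (fun t : ℝ => I / m * ((a + t * I : ℂ) ^ m)⁻¹)
      (((a + t * I : ℂ) ^ (m + 1))⁻¹) t := by
    have h0 := line_ne_zero ha t
    have h1 : HasDerivAt (fun t : ℝ => (a + t * I : ℂ)) I t := by
      simpa using ((hasDerivAt_id t).ofReal_comp.mul_const I).const_add (a : ℂ)
    have h2 := ((h1.pow m).inv (pow_ne_zero _ h0)).const_mul (I / m : ℂ)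
    convert! h2 using 1
    obtain ⟨k, rfl⟩ := Nat.exists_eq_succ_of_ne_zero hm
    have hk : ((k + 1 : ℕ) : ℂ) ≠ 0 := Nat.cast_ne_zero.2 hm
    simp only [Nat.succ_eq_add_one, Nat.add_sub_cancel, Pi.pow_apply]
    field_simp
    rw [I_sq]
    ring
  have hint (T : ℝ) : (∫ t in (-T)..T, ((a + t * I : ℂ) ^ (m + 1))⁻¹) =
      I / m * ((a + T * I : ℂ) ^ m)⁻¹ - I / m * ((a + (-T : ℝ) * I : ℂ) ^ m)⁻¹ :=
    intervalIntegral.integral_eq_sub_of_hasDerivAt (fun t _ => hderiv t)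
      ((continuous_inv_pow_line ha _).intervalIntegrable _ _)
  have hlim (c : ℝ) (hc : |c| = 1) :
      Tendsto (fun T : ℝ => ((a + (c * T : ℝ) * I : ℂ) ^ m)⁻¹) atTop (𝓝 0) := by
    have h1 : Tendsto (fun T : ℝ => ‖(a + (c * T : ℝ) * I : ℂ)‖) atTop atTop := by
      refine tendsto_atTop_mono (fun T => ?_) tendsto_id
      refine le_trans ?_ (abs_im_le_norm _)
      simp only [add_im, ofReal_im, mul_im, ofReal_re, I_im, I_re]
      simp only [mul_one, mul_zero, add_zero, zero_add, abs_mul, hc, one_mul]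
      exact le_abs_self T
    rw [tendsto_zero_iff_norm_tendsto_zero]
    simp only [norm_inv, norm_pow]
    exact ((tendsto_pow_atTop hm).comp h1).inv_tendsto_atTop
  have h1 := hlim 1 (by simp)
  have h2 := hlim (-1) (by simp)
  simp only [one_mul, neg_one_mul] at h1 h2
  simpa [hint] using (h1.const_mul (I / m : ℂ)).sub (h2.const_mul (I / m : ℂ))

theorem tendsto_integral_inv_line_sub_line :
    Tendsto (fun T : ℝ => ∫ t in (-T)..T, (((1 / 2 : ℝ) + t * I : ℂ)⁻¹ -
      ((-(1 / 2) : ℝ) + t * I : ℂ)⁻¹)) atTop (𝓝 (2 * π)) := by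
  have hfun (t : ℝ) : (((1 / 2 : ℝ) + t * I : ℂ)⁻¹ - ((-(1 / 2) : ℝ) + t * I : ℂ)⁻¹) =
      ((4 * (1 + (2 * t) ^ 2)⁻¹ : ℝ) : ℂ) := by
    have h1 := line_ne_zero (a := 1 / 2) (by norm_num) t
    have h2 := line_ne_zero (a := -(1 / 2)) (by norm_num) t
    have h3 : (1 + (2 * t) ^ 2 : ℂ) ≠ 0 := by
      have : (0 : ℝ) < 1 + (2 * t) ^ 2 := by positivity
      exact_mod_cast this.ne'
    rw [inv_sub_inv h1 h2]
    push_cast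
    rw [eq_comm, ← div_eq_mul_inv, div_eq_div_iff h3 (by
      have := mul_ne_zero h1 h2
      push_cast at this
      exact this)]
    linear_combination (4 * (t : ℂ) ^ 2) * I_sq
  have hi : Integrable fun t : ℝ => 4 * (1 + (2 * t) ^ 2)⁻¹ :=
    (integrable_inv_one_add_sq.comp_mul_left' (by norm_num : (2 : ℝ) ≠ 0)).const_mul 4
  have hval : ∫ t : ℝ, 4 * (1 + (2 * t) ^ 2)⁻¹ = 2 * π := by
    rw [integral_const_mul, Measure.integral_comp_mul_left (fun t : ℝ => (1 + t ^ 2)⁻¹) 2,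
      integral_univ_inv_one_add_sq]
    norm_num [abs_of_pos]
    ring
  simp_rw [hfun]
  have := intervalIntegral_tendsto_integral (hi.ofReal (𝕜 := ℂ)) tendsto_neg_atTop_atBot tendsto_id
  rw [integral_ofReal, hval] at this
  simpa using this

/-- Residue formula for the pole of `g s / s ^ (n + 1)` at the origin between two vertical lines. -/
theorem tendsto_integral_line_sub_line {g : ℂ → ℂ} {C : ℝ} (n : ℕ)
    (hd : DifferentiableOn ℂ g {s : ℂ | |s.re| < 1})
    (hC : ∀ s : ℂ, |s.re| ≤ 1 / 2 → ‖g s‖ ≤ C) :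
    Tendsto (fun T : ℝ => ∫ t in (-T)..T,
      (g ((1 / 2 : ℝ) + t * I) / ((1 / 2 : ℝ) + t * I) ^ (n + 1) -
        g ((-(1 / 2) : ℝ) + t * I) / ((-(1 / 2) : ℝ) + t * I) ^ (n + 1))) atTop
      (𝓝 (2 * π * (iteratedDeriv n g 0 / (n.factorial : ℂ)))) := by
  obtain ⟨h, hh, htaylor⟩ := exists_taylor_remainder
    (isOpen_strip.mem_nhds (show |(0 : ℂ).re| < 1 by simp)) hd (n + 1)
  set a : ℕ → ℂ := fun k => iteratedDeriv k g 0 / (k.factorial : ℂ) with ha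
  have hhC : ∀ s : ℂ, |s.re| ≤ 1 / 2 → 1 ≤ |s.im| →
      ‖h s‖ ≤ (C + ∑ k ∈ Finset.range (n + 1), ‖a k‖) / |s.im| := by
    intro s hs1 hs2
    have him : |s.im| ≤ ‖s‖ := abs_im_le_norm s
    have hs : 1 ≤ ‖s‖ := hs2.trans him
    have hC0 : 0 ≤ C := (norm_nonneg _).trans (hC s hs1)
    have h1 : ‖s‖ ^ (n + 1) * ‖h s‖ ≤ ‖s‖ ^ n * (C + ∑ k ∈ Finset.range (n + 1), ‖a k‖) := by
      have : s ^ (n + 1) * h s = g s - ∑ k ∈ Finset.range (n + 1), a k * s ^ k := by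
        rw [htaylor s]; ring
      rw [← norm_pow, ← norm_mul, this]
      refine (norm_sub_le _ _).trans ?_
      rw [mul_add]
      refine add_le_add ?_ ?_
      · exact (hC s hs1).trans (le_mul_of_one_le_left hC0 (one_le_pow₀ hs))
      · refine (norm_sum_le _ _).trans ?_
        rw [Finset.mul_sum]
        refine Finset.sum_le_sum fun k hk => ?_
        rw [norm_mul, norm_pow, mul_comm]
        gcongr ?_ * _
        refine pow_le_pow_right₀ hs ?_
        exact Nat.lt_succ_iff.1 (Finset.mem_range.1 hk)
    rw [pow_succ, mul_assoc] at h1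
    have h2 := le_of_mul_le_mul_left h1 (by positivity)
    rw [le_div_iff₀ (by linarith), mul_comm]
    exact (mul_le_mul_of_nonneg_right him (norm_nonneg _)).trans h2
  have hlim0 := tendsto_integral_line_sub_line_of_differentiableOn hh hhC
  have hne1 : (1 / 2 : ℝ) ≠ 0 := by norm_num
  have hne2 : (-(1 / 2) : ℝ) ≠ 0 := by norm_num
  have hcont (c : ℝ) (hc : |c| < 1) : Continuous fun t : ℝ => h (c + t * I) :=
    hh.continuousOn.comp_continuous (by fun_prop) fun t => by simpa using hc
  have hterm : ∀ k ∈ Finset.range (n + 1), Tendsto (fun T : ℝ => ∫ t in (-T)..T,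
      a k * ((((1 / 2 : ℝ) + t * I : ℂ) ^ (n - k + 1))⁻¹ -
        (((-(1 / 2) : ℝ) + t * I : ℂ) ^ (n - k + 1))⁻¹)) atTop
      (𝓝 (if k = n then 2 * π * a n else 0)) := by
    intro k hk
    simp_rw [intervalIntegral.integral_const_mul]
    split_ifs with hkn
    · subst hkn
      rw [mul_comm]
      simpa using tendsto_integral_inv_line_sub_line.const_mul (a k)
    · have hm : n - k ≠ 0 := by
        have := Finset.mem_range.1 hk
        omega
      have := ((tendsto_integral_inv_pow_line hne1 hm).sub
        (tendsto_integral_inv_pow_line hne2 hm)).const_mul (a k)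
      simp only [sub_zero, mul_zero] at this
      refine this.congr fun T => ?_
      rw [intervalIntegral.integral_sub
        ((continuous_inv_pow_line hne1 _).intervalIntegrable _ _)
        ((continuous_inv_pow_line hne2 _).intervalIntegrable _ _)]
  have hsum := (tendsto_finsetSum _ hterm).add hlim0
  rw [Finset.sum_ite_eq' _ n, if_pos (by simp), add_zero] at hsum
  refine hsum.congr fun T => ?_
  rw [← intervalIntegral.integral_finsetSum, ← intervalIntegral.integral_add]
  · refine intervalIntegral.integral_congr fun t _ => ?_
    have hline (c : ℝ) (hc : c ≠ 0) : g (c + t * I) / (c + t * I) ^ (n + 1) =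
        (∑ k ∈ Finset.range (n + 1), a k * ((c + t * I : ℂ) ^ (n - k + 1))⁻¹) +
          h (c + t * I) := by
      have h0 := line_ne_zero hc t
      rw [htaylor, add_div, mul_div_cancel_left₀ _ (pow_ne_zero _ h0), Finset.sum_div]
      congr 1
      refine Finset.sum_congr rfl fun k hk => ?_
      have hkn : n + 1 = (n - k + 1) + k := by
        have := Finset.mem_range.1 hk
        omega
      rw [hkn, pow_add _ (n - k + 1) k, ha]
      field_simp
    simp only [hline _ hne1, hline _ hne2, mul_sub, Finset.sum_sub_distrib]
    ring
  · refine Continuous.intervalIntegrable (continuous_finsetSum _ fun k _ => ?_) _ _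
    exact continuous_const.mul
      ((continuous_inv_pow_line hne1 _).sub (continuous_inv_pow_line hne2 _))
  · exact ((hcont _ (by norm_num [abs_of_pos])).sub
      (hcont _ (by norm_num [abs_of_pos]))).intervalIntegrable _ _
  · intro k _
    exact (continuous_const.mul ((continuous_inv_pow_line hne1 _).sub
      (continuous_inv_pow_line hne2 _))).intervalIntegrable _ _

theorem norm_Gamma_le_Gamma_re {s : ℂ} (hs : 0 < s.re) : ‖Gamma s‖ ≤ Real.Gamma s.re := by
  rw [Gamma_eq_integral hs, Real.Gamma_eq_integral hs, GammaIntegral]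
  refine (norm_integral_le_integral_norm _).trans_eq
    (setIntegral_congr_fun measurableSet_Ioi fun x hx => ?_)
  have hx' : (0 : ℝ) < x := hx
  simp only [norm_mul, norm_cpow_eq_rpow_re_of_pos hx', norm_real, Real.norm_eq_abs, Real.abs_exp]
  simp

theorem Gamma_add_nat_eq_mul_prod {s : ℂ} {k : ℕ} (hs : ∀ j < k, s + j ≠ 0) :
    Gamma (s + k) = Gamma s * ∏ j ∈ Finset.range k, (s + j) := by
  induction k with
  | zero => simp
  | succ k ih =>
    rw [Finset.prod_range_succ, Nat.cast_succ, ← add_assoc, Gamma_add_one _ (hs k k.lt_succ_self),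
      ih fun j hj => hs j (hj.trans k.lt_succ_self)]
    ring

theorem factorial_div_two_pow_le_prod_norm (N : ℕ) (t : ℝ) :
    (N.factorial : ℝ) / 2 ^ N ≤
      ∏ j ∈ Finset.range N, ‖((1 / 2 - N : ℝ) + t * I + j : ℂ)‖ := by
  have hfac : (N.factorial : ℝ) / 2 ^ N =
      ∏ j ∈ Finset.range N, (((N - 1 - j : ℕ) : ℝ) + 1) / 2 := by
    rw [Finset.prod_div_distrib, Finset.prod_const, Finset.card_range,
      Finset.prod_range_reflect (fun j : ℕ => (j : ℝ) + 1)]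
    exact_mod_cast congrArg (fun x : ℕ => (x : ℝ) / 2 ^ N)
      (Finset.prod_range_add_one_eq_factorial N).symm
  rw [hfac]
  refine Finset.prod_le_prod (fun j _ => by positivity) fun j hj => ?_
  have hjN := Finset.mem_range.1 hj
  have hcast : ((N - 1 - j : ℕ) : ℝ) + 1 = N - j := by
    rw [Nat.sub_sub, Nat.cast_sub (by omega)]
    push_cast
    ring
  have hj1 : (j : ℝ) + 1 ≤ N := by exact_mod_cast hjN
  refine le_trans ?_ (abs_re_le_norm _)
  simp only [add_re, ofReal_re, mul_re, I_re, ofReal_im, I_im, natCast_re]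
  rw [hcast, abs_of_nonpos (by linarith)]
  linarith

theorem quarter_add_sq_le_norm_mul_norm (t : ℝ) :
    1 / 4 + t ^ 2 ≤ ‖((1 / 2 : ℝ) + t * I : ℂ)‖ * ‖((1 / 2 : ℝ) + t * I + 1 : ℂ)‖ := by
  have h1 : 1 / 4 + t ^ 2 = ‖((1 / 2 : ℝ) + t * I : ℂ)‖ ^ 2 := by
    rw [← normSq_eq_norm_sq, normSq_add_mul_I]
    ring
  have h2 : ‖((1 / 2 : ℝ) + t * I : ℂ)‖ ≤ ‖((1 / 2 : ℝ) + t * I + 1 : ℂ)‖ := by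
    refine abs_le_of_sq_le_sq' ?_ (norm_nonneg _) |>.2
    have h3 : ((1 / 2 : ℝ) + t * I + 1 : ℂ) = (3 / 2 : ℝ) + t * I := by push_cast; ring
    rw [h3, ← normSq_eq_norm_sq, ← normSq_eq_norm_sq, normSq_add_mul_I, normSq_add_mul_I]
    norm_num
  rw [h1, sq]
  gcongr

theorem half_sub_nat_line_ne_neg_nat (N m : ℕ) (t : ℝ) :
    ((1 / 2 - N : ℝ) + t * I : ℂ) ≠ -m := by
  intro h
  have hre := congrArg re h
  simp only [add_re, ofReal_re, mul_re, I_re, ofReal_im, I_im, neg_re, natCast_re] at hre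
  have : (2 * N : ℝ) = 2 * m + 1 := by linarith
  have : 2 * N = 2 * m + 1 := by exact_mod_cast this
  omega

theorem norm_Gamma_half_sub_nat_line_le (N : ℕ) (t : ℝ) :
    ‖Gamma ((1 / 2 - N : ℝ) + t * I)‖ ≤
      4 * Real.Gamma (5 / 2) * (2 ^ N / N.factorial) * (1 + (2 * t) ^ 2)⁻¹ := by
  set s : ℂ := (1 / 2 - N : ℝ) + t * I with hs
  have hne (j : ℕ) : s + j ≠ 0 := fun h =>
    half_sub_nat_line_ne_neg_nat N j t (eq_neg_of_add_eq_zero_left h)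
  have hfun := Gamma_add_nat_eq_mul_prod (k := N + 2) fun j _ => hne j
  have hre : (s + (N + 2 : ℕ)).re = 5 / 2 := by
    simp only [hs, add_re, ofReal_re, mul_re, I_re, ofReal_im, I_im, natCast_re]
    push_cast
    ring
  have hG := norm_Gamma_le_Gamma_re (s := s + (N + 2 : ℕ)) (by rw [hre]; norm_num)
  rw [hre, hfun, norm_mul, norm_prod, Finset.prod_range_succ, Finset.prod_range_succ] at hG
  have hsN : s + N = (1 / 2 : ℝ) + t * I := by rw [hs]; push_cast; ring
  have hsN1 : s + (N + 1 : ℕ) = (1 / 2 : ℝ) + t * I + 1 := by rw [hs]; push_cast; ring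
  rw [hsN, hsN1, mul_assoc (∏ _ ∈ _, _)] at hG
  have hlow : (N.factorial : ℝ) / 2 ^ N * (1 / 4 + t ^ 2) ≤
      (∏ j ∈ Finset.range N, ‖s + j‖) *
        (‖((1 / 2 : ℝ) + t * I : ℂ)‖ * ‖((1 / 2 : ℝ) + t * I + 1 : ℂ)‖) :=
    mul_le_mul (factorial_div_two_pow_le_prod_norm N t) (quarter_add_sq_le_norm_mul_norm t)
      (by positivity) (Finset.prod_nonneg fun _ _ => norm_nonneg _)
  have hmain := (mul_le_mul_of_nonneg_left hlow (norm_nonneg (Gamma s))).trans hG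
  rw [← le_div_iff₀ (by positivity)] at hmain
  refine hmain.trans_eq ?_
  field_simp
  ring

/-- The integrand `q^{-s} z^{(n+1)s} Γ(s)^{n+1}` of the Mellin–Barnes representation. -/
noncomputable def barnesKernel (n : ℕ) (z q : ℝ) (s : ℂ) : ℂ :=
  exp (-s * Real.log q) * exp (((n : ℂ) + 1) * s * Real.log z) * Gamma s ^ (n + 1)

theorem norm_exp_mul_exp (n : ℕ) (z q : ℝ) (s : ℂ) :
    ‖exp (-s * Real.log q) * exp (((n : ℂ) + 1) * s * Real.log z)‖ =
      Real.exp (s.re * ((n + 1) * Real.log z - Real.log q)) := by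
  rw [← exp_add, norm_exp]
  congr 1
  have : -s * Real.log q + ((n : ℂ) + 1) * s * Real.log z =
      s * (((n + 1) * Real.log z - Real.log q : ℝ) : ℂ) := by
    push_cast
    ring
  rw [this, re_mul_ofReal]

theorem exists_norm_barnesKernel_le (n : ℕ) (z q : ℝ) : ∃ K b : ℝ, ∀ (N : ℕ) (t : ℝ),
    ‖barnesKernel n z q ((1 / 2 - N : ℝ) + t * I)‖ ≤
      K * (b ^ N / N.factorial) * (1 + (2 * t) ^ 2)⁻¹ := by
  set L : ℝ := (n + 1) * Real.log z - Real.log q with hL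
  refine ⟨Real.exp (L / 2) * (4 * Real.Gamma (5 / 2)) ^ (n + 1),
    Real.exp (-L) * 2 ^ (n + 1), fun N t => ?_⟩
  have hGpos : 0 < Real.Gamma (5 / 2) := Real.Gamma_pos_of_pos (by norm_num)
  rw [barnesKernel, norm_mul, norm_exp_mul_exp, norm_pow, ← hL]
  have hre : ((1 / 2 - N : ℝ) + t * I : ℂ).re = 1 / 2 - N := by simp
  have hexp : Real.exp ((1 / 2 - N) * L) = Real.exp (L / 2) * Real.exp (-L) ^ N := by
    rw [← Real.exp_nat_mul, ← Real.exp_add]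
    congr 1
    ring
  rw [hre, hexp]
  have hx0 : 0 < (1 + (2 * t) ^ 2)⁻¹ := by positivity
  have hx1 : (1 + (2 * t) ^ 2)⁻¹ ≤ 1 := inv_le_one_of_one_le₀ (by nlinarith [sq_nonneg (2 * t)])
  have hxpow : ((1 + (2 * t) ^ 2)⁻¹) ^ (n + 1) ≤ (1 + (2 * t) ^ 2)⁻¹ :=
    pow_le_of_le_one hx0.le hx1 n.succ_ne_zero
  have hfac : ((2 : ℝ) ^ N / N.factorial) ^ (n + 1) ≤ (2 ^ (n + 1)) ^ N / N.factorial := by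
    rw [div_pow, ← pow_mul, ← pow_mul, mul_comm N]
    gcongr
    exact le_self_pow₀ (by exact_mod_cast N.factorial_pos) n.succ_ne_zero
  have hG := pow_le_pow_left₀ (norm_nonneg _) (norm_Gamma_half_sub_nat_line_le N t) (n + 1)
  rw [mul_pow, mul_pow _ (2 ^ N / (N.factorial : ℝ))] at hG
  calc _ ≤ Real.exp (L / 2) * Real.exp (-L) ^ N * ((4 * Real.Gamma (5 / 2)) ^ (n + 1) *
        ((2 ^ (n + 1)) ^ N / N.factorial) * (1 + (2 * t) ^ 2)⁻¹) := by
        gcongr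
        refine hG.trans ?_
        gcongr
    _ = _ := by
        rw [mul_pow (Real.exp (-L))]
        ring

theorem continuous_Gamma_half_sub_nat_line (N : ℕ) :
    Continuous fun t : ℝ => Gamma ((1 / 2 - N : ℝ) + t * I) :=
  continuous_iff_continuousAt.2 fun t =>
    ContinuousAt.comp (f := fun t : ℝ => ((1 / 2 - N : ℝ) + t * I : ℂ))
      (differentiableAt_Gamma _ fun m => half_sub_nat_line_ne_neg_nat N m t).continuousAt
      (by fun_prop)

theorem continuous_barnesKernel_line (n : ℕ) (z q : ℝ) (N : ℕ) :
    Continuous fun t : ℝ => barnesKernel n z q ((1 / 2 - N : ℝ) + t * I) := by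
  unfold barnesKernel
  exact Continuous.mul (by fun_prop) ((continuous_Gamma_half_sub_nat_line N).pow _)

theorem integrable_inv_one_add_two_mul_sq : Integrable fun t : ℝ => (1 + (2 * t) ^ 2)⁻¹ :=
  integrable_inv_one_add_sq.comp_mul_left' (by norm_num : (2 : ℝ) ≠ 0)

theorem integrable_barnesKernel_line (n : ℕ) (z q : ℝ) (N : ℕ) :
    Integrable fun t : ℝ => barnesKernel n z q ((1 / 2 - N : ℝ) + t * I) := by
  obtain ⟨K, b, h⟩ := exists_norm_barnesKernel_le n z q
  exact (integrable_inv_one_add_two_mul_sq.const_mul _).mono'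
    (continuous_barnesKernel_line n z q N).aestronglyMeasurable (.of_forall (h N))

theorem summable_norm_integral_barnesKernel (n : ℕ) (z q : ℝ) :
    Summable fun N : ℕ => ‖∫ t : ℝ, barnesKernel n z q ((1 / 2 - N : ℝ) + t * I)‖ := by
  obtain ⟨K, b, h⟩ := exists_norm_barnesKernel_le n z q
  refine Summable.of_nonneg_of_le (fun _ => norm_nonneg _) (fun N => ?_)
    (((Real.summable_pow_div_factorial b).mul_left K).mul_right (∫ t : ℝ, (1 + (2 * t) ^ 2)⁻¹))
  rw [← integral_const_mul]
  exact norm_integral_le_of_norm_le (integrable_inv_one_add_two_mul_sq.const_mul _)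
    (.of_forall (h N))

theorem sub_nat_add_ne_zero {w : ℂ} (hw : |w.re| < 1) {d j : ℕ} (hj : j < d) :
    w - d + j ≠ 0 := by
  intro h
  have hre := congrArg re h
  simp only [add_re, sub_re, natCast_re, zero_re] at hre
  have : (j : ℝ) + 1 ≤ d := by exact_mod_cast hj
  linarith [(abs_lt.1 hw).2]

theorem barnesKernel_sub_nat (n : ℕ) (z q : ℝ) (d : ℕ) {w : ℂ} (hw : |w.re| < 1) (hw0 : w ≠ 0) :
    barnesKernel n z q (w - d) = residueFunction n z q d (w - d) / w ^ (n + 1) := by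
  have hne : ∀ j < d + 1, w - d + j ≠ 0 := by
    intro j hj
    rcases Nat.lt_succ_iff_lt_or_eq.1 hj with h | rfl
    · exact sub_nat_add_ne_zero hw h
    · simpa using hw0
  have hG := Gamma_add_nat_eq_mul_prod hne
  rw [Finset.prod_range_succ, Nat.cast_succ, ← add_assoc, sub_add_cancel] at hG
  have hprod : ∏ j ∈ Finset.range d, (w - d + j) ≠ 0 :=
    Finset.prod_ne_zero_iff.2 fun j hj => sub_nat_add_ne_zero hw (Finset.mem_range.1 hj)
  rw [barnesKernel, residueFunction, sub_add_cancel, hG, mul_div_assoc, ← div_pow]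
  congr 2
  field_simp

theorem differentiableOn_residueFunction_sub_nat (n : ℕ) (z q : ℝ) (d : ℕ) :
    DifferentiableOn ℂ (fun w => residueFunction n z q d (w - d)) {w : ℂ | |w.re| < 1} := by
  intro w hw
  have hw' : |w.re| < 1 := hw
  refine DifferentiableAt.differentiableWithinAt ?_
  have hprod : ∏ j ∈ Finset.range d, (w - d + j) ≠ 0 :=
    Finset.prod_ne_zero_iff.2 fun j hj => sub_nat_add_ne_zero hw' (Finset.mem_range.1 hj)
  have hG : DifferentiableAt ℂ Gamma (w - d + d + 1) := by
    refine differentiableAt_Gamma _ fun m h => ?_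
    have hre := congrArg re h
    simp only [sub_add_cancel, add_re, one_re, neg_re, natCast_re] at hre
    have : (0 : ℝ) ≤ m := m.cast_nonneg
    linarith [(abs_lt.1 hw').1]
  have hnum : DifferentiableAt ℂ (fun w : ℂ => Gamma (w - d + d + 1)) w :=
    DifferentiableAt.comp (f := fun w : ℂ => w - d + d + 1) w hG (by fun_prop)
  have hden : DifferentiableAt ℂ (fun w : ℂ => ∏ j ∈ Finset.range d, (w - d + j)) w :=
    DifferentiableAt.fun_finsetProd fun j _ => by fun_prop
  have hexp : DifferentiableAt ℂ (fun w : ℂ =>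
      exp (-(w - d) * Real.log q) * exp (((n : ℂ) + 1) * (w - d) * Real.log z)) w := by
    fun_prop
  exact hexp.mul ((hnum.div hden hprod).pow (n + 1))

theorem exists_norm_residueFunction_sub_nat_le (n : ℕ) (z q : ℝ) (d : ℕ) :
    ∃ C : ℝ, ∀ w : ℂ, |w.re| ≤ 1 / 2 → ‖residueFunction n z q d (w - d)‖ ≤ C := by
  set L : ℝ := (n + 1) * Real.log z - Real.log q with hL
  obtain ⟨M, hM⟩ : ∃ M : ℝ, ∀ x ∈ Icc (1 / 2 : ℝ) (3 / 2), ‖Real.Gamma x‖ ≤ M :=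
    isCompact_Icc.exists_bound_of_continuousOn
      (Real.differentiableOn_Gamma_Ioi.continuousOn.mono fun x hx =>
        show (0 : ℝ) < x from lt_of_lt_of_le (by norm_num) hx.1)
  refine ⟨Real.exp ((1 / 2 + d) * |L|) * (M / (1 / 2) ^ d) ^ (n + 1), fun w hw => ?_⟩
  have hw' := abs_le.1 hw
  rw [residueFunction, norm_mul, norm_exp_mul_exp, norm_pow, norm_div, norm_prod, ← hL,
    sub_add_cancel]
  have hd0 : (0 : ℝ) ≤ d := d.cast_nonneg
  have hGM : ‖Gamma (w + 1)‖ ≤ M := by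
    have hre : (w + 1).re = w.re + 1 := by simp
    refine (norm_Gamma_le_Gamma_re (by rw [hre]; linarith)).trans ((le_abs_self _).trans ?_)
    exact hM _ (by rw [hre]; constructor <;> linarith)
  have hprod : (1 / 2 : ℝ) ^ d ≤ ∏ j ∈ Finset.range d, ‖w - d + j‖ := by
    have : (1 / 2 : ℝ) ^ d = ∏ _j ∈ Finset.range d, (1 / 2 : ℝ) := by simp
    rw [this]
    refine Finset.prod_le_prod (fun _ _ => by norm_num) fun j hj => ?_
    have hj1 : (j : ℝ) + 1 ≤ d := by exact_mod_cast Finset.mem_range.1 hj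
    refine le_trans ?_ (abs_re_le_norm _)
    simp only [add_re, sub_re, natCast_re]
    rw [abs_of_nonpos (by linarith)]
    linarith
  have hexp : (w - d).re * L ≤ (1 / 2 + d) * |L| := by
    refine (le_abs_self _).trans ?_
    rw [abs_mul]
    gcongr
    simp only [sub_re, natCast_re]
    rw [abs_le]
    constructor <;> linarith
  have hM0 : 0 ≤ M := (norm_nonneg _).trans hGM
  gcongr

theorem integral_barnesKernel_sub_succ (n : ℕ) (z q : ℝ) (d : ℕ) :
    (∫ t : ℝ, barnesKernel n z q ((1 / 2 - d : ℝ) + t * I)) -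
      (∫ t : ℝ, barnesKernel n z q ((1 / 2 - (d + 1 : ℕ) : ℝ) + t * I)) =
      2 * π * (iteratedDeriv n (residueFunction n z q d) (-(d : ℂ)) / (n.factorial : ℂ)) := by
  obtain ⟨C, hC⟩ := exists_norm_residueFunction_sub_nat_le n z q d
  have hres := tendsto_integral_line_sub_line n
    (differentiableOn_residueFunction_sub_nat n z q d) hC
  rw [iteratedDeriv_comp_sub_const] at hres
  simp only [zero_sub] at hres
  have hint := intervalIntegral_tendsto_integral ((integrable_barnesKernel_line n z q d).sub
    (integrable_barnesKernel_line n z q (d + 1))) tendsto_neg_atTop_atBot tendsto_id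
  rw [← integral_sub (integrable_barnesKernel_line n z q d)
    (integrable_barnesKernel_line n z q (d + 1))]
  refine tendsto_nhds_unique hint (hres.congr fun T => ?_)
  refine intervalIntegral.integral_congr fun t _ => ?_
  have h1 : ((1 / 2 - d : ℝ) + t * I : ℂ) = ((1 / 2 : ℝ) + t * I) - d := by push_cast; ring
  have h2 : ((1 / 2 - (d + 1 : ℕ) : ℝ) + t * I : ℂ) = ((-(1 / 2) : ℝ) + t * I) - d := by
    push_cast; ring
  simp only [Pi.sub_apply]
  rw [h1, h2, barnesKernel_sub_nat _ _ _ _ (by norm_num [abs_of_pos])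
    (line_ne_zero (by norm_num) t),
    barnesKernel_sub_nat _ _ _ _ (by norm_num [abs_of_pos]) (line_ne_zero (by norm_num) t)]

theorem hasSum_residues_barnesKernel (n : ℕ) (z q : ℝ) :
    HasSum (fun d : ℕ =>
        (1 / (n.factorial : ℂ)) * iteratedDeriv n (residueFunction n z q d) (-(d : ℂ)))
      ((1 / (2 * π) : ℝ) • ∫ t : ℝ, barnesKernel n z q ((1 / 2 : ℝ) + t * I)) := by
  set J : ℕ → ℂ := fun N => ∫ t : ℝ, barnesKernel n z q ((1 / 2 - N : ℝ) + t * I) with hJ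
  have hsumm : Summable J := (summable_norm_integral_barnesKernel n z q).of_norm
  have hterm (d : ℕ) : (1 / (n.factorial : ℂ)) *
      iteratedDeriv n (residueFunction n z q d) (-(d : ℂ)) =
      (1 / (2 * π) : ℝ) • (J d - J (d + 1)) := by
    rw [hJ, integral_barnesKernel_sub_succ, real_smul]
    have := ofReal_ne_zero.2 Real.pi_ne_zero
    push_cast
    field_simp
  simp_rw [hterm]
  refine HasSum.const_smul _ ?_
  have hJ0 : (∫ t : ℝ, barnesKernel n z q ((1 / 2 : ℝ) + t * I)) = J 0 := by simp [hJ]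
  rw [hJ0, (hsumm.sub ((summable_nat_add_iff 1).2 hsumm)).hasSum_iff_tendsto_nat]
  simp_rw [Finset.sum_range_sub']
  simpa using hsumm.tendsto_atTop_zero.const_sub (J 0)

theorem integrable_Gamma_half_line : Integrable fun t : ℝ => Gamma ((1 / 2 : ℝ) + t * I) := by
  have hbound := norm_Gamma_half_sub_nat_line_le 0
  have hcont := continuous_Gamma_half_sub_nat_line 0
  simp only [Nat.cast_zero, sub_zero] at hbound hcont
  exact (integrable_inv_one_add_two_mul_sq.const_mul _).mono' hcont.aestronglyMeasurable
    (.of_forall hbound)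

theorem exp_neg_eq_integral_Gamma {y : ℝ} (hy : 0 < y) :
    (Real.exp (-y) : ℂ) = (1 / (2 * π) : ℝ) •
      ∫ t : ℝ, (y : ℂ) ^ (-((1 / 2 : ℝ) + t * I : ℂ)) * Gamma ((1 / 2 : ℝ) + t * I) := by
  have hmellin (t : ℝ) : mellin (fun x : ℝ => (Real.exp (-x) : ℂ)) ((1 / 2 : ℝ) + t * I) =
      Gamma ((1 / 2 : ℝ) + t * I) := by
    rw [Gamma_eq_integral (by simp), GammaIntegral_eq_mellin]
  have hconv : MellinConvergent (fun x : ℝ => (Real.exp (-x) : ℂ)) (1 / 2 : ℝ) := by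
    refine (GammaIntegral_convergent (s := (1 / 2 : ℝ)) (by simp)).congr_fun (fun x _ => ?_)
      measurableSet_Ioi
    simp [mul_comm]
  have hvert : VerticalIntegrable (mellin fun x : ℝ => (Real.exp (-x) : ℂ)) (1 / 2 : ℝ) := by
    simp only [VerticalIntegrable, hmellin]
    exact integrable_Gamma_half_line
  rw [← mellinInv_mellin_eq (1 / 2) (fun x : ℝ => (Real.exp (-x) : ℂ)) hy hconv hvert
    (by fun_prop), mellinInv]
  simp only [hmellin, smul_eq_mul]

theorem integrableOn_rpow_mul_exp_neg_div {z : ℝ} (hz : 0 < z) :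
    IntegrableOn (fun x : ℝ => x ^ (-(1 / 2) : ℝ) * Real.exp (-(z⁻¹ * x))) (Ioi 0) := by
  have := integrableOn_rpow_mul_exp_neg_mul_rpow (p := 1) (s := -(1 / 2)) (b := z⁻¹)
    (by norm_num) one_pos (by positivity)
  simpa using this

theorem norm_cpow_mul_exp_neg_div {x : ℝ} (hx : 0 < x) (z t : ℝ) :
    ‖(x : ℂ) ^ ((1 / 2 : ℝ) + t * I - 1 : ℂ) * exp (-((z⁻¹ : ℝ) * x))‖ =
      x ^ (-(1 / 2) : ℝ) * Real.exp (-(z⁻¹ * x)) := by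
  rw [norm_mul, norm_cpow_eq_rpow_re_of_pos hx, norm_exp]
  congr 2
  · simp
    norm_num
  · simp

theorem prod_ofReal_cpow {ι : Type*} (u : Finset ι) {x : ι → ℝ} (hx : ∀ i ∈ u, 0 ≤ x i) (s : ℂ) :
    ∏ i ∈ u, (x i : ℂ) ^ s = ((∏ i ∈ u, x i : ℝ) : ℂ) ^ s := by
  classical
  induction u using Finset.induction_on with
  | empty => simp
  | insert a u ha ih =>
    have hu : ∀ i ∈ u, 0 ≤ x i := fun i hi => hx i (Finset.mem_insert_of_mem hi)
    rw [Finset.prod_insert ha, Finset.prod_insert ha, ih hu, ofReal_mul,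
      mul_cpow_ofReal_nonneg (hx a (Finset.mem_insert_self a u)) (Finset.prod_nonneg hu)]

theorem mirror_integrand_eq {n : ℕ} {z q : ℝ} (hz : 0 < z) (hq : 0 < q) {x : Fin n → ℝ}
    (hx : ∀ i, 0 < x i) :
    ((Real.exp (-(∑ i, x i + q / ∏ i, x i) / z) / ∏ i, x i : ℝ) : ℂ) =
      (1 / (2 * π) : ℝ) • ∫ t : ℝ,
        (((q / z : ℝ) : ℂ) ^ (-((1 / 2 : ℝ) + t * I : ℂ)) * Gamma ((1 / 2 : ℝ) + t * I)) *
          ∏ i, (x i : ℂ) ^ ((1 / 2 : ℝ) + t * I - 1 : ℂ) * exp (-((z⁻¹ : ℝ) * x i)) := by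
  have hP : 0 < ∏ i, x i := Finset.prod_pos fun i _ => hx i
  have hsplit : Real.exp (-(∑ i, x i + q / ∏ i, x i) / z) / ∏ i, x i =
      (∏ i, (x i)⁻¹ * Real.exp (-(z⁻¹ * x i))) * Real.exp (-(q / z / ∏ i, x i)) := by
    rw [Finset.prod_mul_distrib, Finset.prod_inv_distrib, ← Real.exp_sum, mul_assoc,
      ← Real.exp_add, Finset.sum_neg_distrib, ← Finset.mul_sum, div_eq_inv_mul]
    congr 2
    field_simp
    ring
  rw [hsplit, ofReal_mul, exp_neg_eq_integral_Gamma (by positivity), mul_smul_comm,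
    ← integral_const_mul]
  congr 2 with t
  set s : ℂ := (1 / 2 : ℝ) + t * I
  have hpow : ((q / z / ∏ i, x i : ℝ) : ℂ) ^ (-s) =
      ((q / z : ℝ) : ℂ) ^ (-s) * ∏ i, (x i : ℂ) ^ s := by
    have hprod : ∏ i, (x i : ℂ) ^ s = ((∏ i, x i : ℝ) : ℂ) ^ s :=
      prod_ofReal_cpow _ (fun i _ => (hx i).le) s
    rw [hprod, div_eq_mul_inv (q / z), ofReal_mul,
      mul_cpow_ofReal_nonneg (by positivity) (by positivity), ofReal_inv, cpow_neg _⁻¹,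
      inv_cpow _ _ (by rw [arg_ofReal_of_nonneg hP.le]; exact Real.pi_pos.ne), inv_inv]
  have hfac (i : Fin n) : (x i : ℂ) ^ (s - 1) = (x i : ℂ) ^ s * (x i : ℂ)⁻¹ := by
    rw [cpow_sub _ _ (ofReal_ne_zero.2 (hx i).ne'), cpow_one, div_eq_mul_inv]
  rw [hpow]
  simp only [hfac, Finset.prod_mul_distrib]
  push_cast
  ring

theorem integral_mirror_fiber {n : ℕ} {z q : ℝ} (hz : 0 < z) (hq : 0 < q) (t : ℝ) :
    (∫ x in Set.univ.pi fun _ : Fin n => Ioi (0 : ℝ),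
      (((q / z : ℝ) : ℂ) ^ (-((1 / 2 : ℝ) + t * I : ℂ)) * Gamma ((1 / 2 : ℝ) + t * I)) *
        ∏ i, (x i : ℂ) ^ ((1 / 2 : ℝ) + t * I - 1 : ℂ) * exp (-((z⁻¹ : ℝ) * x i))) =
      barnesKernel n z q ((1 / 2 : ℝ) + t * I) := by
  set s : ℂ := (1 / 2 : ℝ) + t * I with hs
  have hzq : ((q / z : ℝ) : ℂ) ≠ 0 := ofReal_ne_zero.2 (by positivity)
  rw [integral_const_mul, volume_pi, Measure.restrict_pi_pi,
    integral_fintype_prod_eq_pow (fun x : ℝ => (x : ℂ) ^ (s - 1) * exp (-((z⁻¹ : ℝ) * x))),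
    integral_cpow_mul_exp_neg_mul_Ioi (by simp [hs]) (by positivity), Fintype.card_fin,
    barnesKernel]
  have h1 : (1 / ((z⁻¹ : ℝ) : ℂ)) ^ s = exp (s * Real.log z) := by
    rw [ofReal_inv, one_div, inv_inv, cpow_def_of_ne_zero (ofReal_ne_zero.2 hz.ne'),
      ofReal_log hz.le,
      mul_comm]
  have h2 : ((q / z : ℝ) : ℂ) ^ (-s) = exp (-s * Real.log q) * exp (s * Real.log z) := by
    rw [cpow_def_of_ne_zero hzq, ← ofReal_log (by positivity), Real.log_div hq.ne' hz.ne',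
      ← exp_add]
    congr 1
    push_cast
    ring
  have h3 : exp (((n : ℂ) + 1) * s * Real.log z) = exp (s * Real.log z) ^ (n + 1) := by
    rw [← exp_nat_mul]
    congr 1
    push_cast
    ring
  rw [h1, h2, h3]
  ring

theorem mirrorOscIntegral_eq_integral_barnesKernel (n : ℕ) {z q : ℝ} (hz : 0 < z) (hq : 0 < q) :
    (mirrorOscIntegral n z q : ℂ) =
      (1 / (2 * π) : ℝ) • ∫ t : ℝ, barnesKernel n z q ((1 / 2 : ℝ) + t * I) := by
  have hmeas : MeasurableSet (Set.univ.pi fun _ : Fin n => Ioi (0 : ℝ)) :=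
    MeasurableSet.univ_pi fun _ => measurableSet_Ioi
  rw [mirrorOscIntegral, ← integral_complex_ofReal,
    setIntegral_congr_fun hmeas fun x hx => mirror_integrand_eq hz hq fun i => hx i (mem_univ i),
    integral_smul]
  congr 1
  rw [integral_integral_swap]
  · exact integral_congr_ae (.of_forall fun t => integral_mirror_fiber hz hq t)
  have hA : Integrable fun t : ℝ =>
      ((q / z : ℝ) : ℂ) ^ (-((1 / 2 : ℝ) + t * I : ℂ)) * Gamma ((1 / 2 : ℝ) + t * I) := by
    refine integrable_Gamma_half_line.bdd_mul (c := (q / z) ^ (-(1 / 2) : ℝ)) ?_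
      (.of_forall fun t => ?_)
    · refine Continuous.aestronglyMeasurable ?_
      exact Continuous.const_cpow (by fun_prop)
        (Or.inl (ofReal_ne_zero.2 (div_pos hq hz).ne'))
    · rw [norm_cpow_eq_rpow_re_of_pos (div_pos hq hz)]
      simp
  have hX : Integrable (fun x : Fin n → ℝ =>
      ∏ i, x i ^ (-(1 / 2) : ℝ) * Real.exp (-(z⁻¹ * x i)))
      (volume.restrict (Set.univ.pi fun _ : Fin n => Ioi (0 : ℝ))) := by
    rw [volume_pi, Measure.restrict_pi_pi]
    exact Integrable.fintype_prod fun _ => integrableOn_rpow_mul_exp_neg_div hz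
  refine (hX.mul_prod hA.norm).mono' ?_ ?_
  · refine AEStronglyMeasurable.mul hA.aestronglyMeasurable.comp_snd ?_
    refine Measurable.aestronglyMeasurable ?_
    fun_prop
  · have hpos : ∀ᵐ x ∂(volume.restrict (Set.univ.pi fun _ : Fin n => Ioi (0 : ℝ))),
        ∀ i, 0 < x i := by
      filter_upwards [ae_restrict_mem hmeas] with x hx i using hx i (mem_univ i)
    filter_upwards [Measure.quasiMeasurePreserving_fst.ae hpos] with p hp
    simp only [Function.uncurry]
    rw [norm_mul, norm_prod, mul_comm]
    refine le_of_eq ?_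
    congr 1
    exact Finset.prod_congr rfl fun i _ => norm_cpow_mul_exp_neg_div (hp i) z p.2

end

/-- for `n ≥ 1` and `z, q > 0`, the series of residues
`Σ_{d≥0} (1/n!) g_d^{(n)}(−d)` converges, with sum the mirror oscillatory
integral `F_{n,z}(q)`. -/
theorem mirrorOscIntegral_eq_sum_of_residues (n : ℕ) (hn : 1 ≤ n) (z q : ℝ)
    (hz : 0 < z) (hq : 0 < q) :
    HasSum
      (fun d : ℕ =>
        (1 / (n.factorial : ℂ)) * iteratedDeriv n (residueFunction n z q d) (-(d : ℂ)))
      (mirrorOscIntegral n z q : ℂ) := by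
  rw [mirrorOscIntegral_eq_integral_barnesKernel n hz hq]
  exact hasSum_residues_barnesKernel n z q
end

section
/- Let n ≥ 1 be an integer and z > 0 a real number. For q > 0 define M_{n,z}(q) = (1/n!) · h_q^{(n)}(0), the n-th complex derivative at p = 0 of the entire function h_q(p) = exp(p · log(z^{n+1}/q)) · Γ(1+p)^{n+1}. Then the mirror oscillatory integral of ℙⁿ has the asymptotics F_{n,z}(q) − M_{n,z}(q) → 0 as q → 0⁺. (This is the mirror-symmetric Gamma statement ∫_{(ℝ_{>0})ⁿ} e^{−W_q/z} Ω₀ ∼ ∫_{ℙⁿ} q^{−p} z^{c₁(ℙⁿ)} ∪ Γ̂_{ℙⁿ}, since M_{n,z}(q) is the coefficient of pⁿ in (z^{n+1}/q)^p Γ(1+p)^{n+1}.) -/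
open MeasureTheory

/-- The entire function `h_q(p) = (z^{n+1}/q)^p Γ(1+p)^{n+1}`. -/
noncomputable def gammaClassFunction (n : ℕ) (z q : ℝ) (p : ℂ) : ℂ :=
  Complex.exp (p * Real.log (z ^ (n + 1) / q)) * Complex.Gamma (1 + p) ^ (n + 1)

/-- The leading term `M_{n,z}(q) = (1/n!) h_q^{(n)}(0)`, i.e. the coefficient of
`pⁿ` in `(z^{n+1}/q)^p Γ(1+p)^{n+1}`, equal to `∫_{ℙⁿ} q^{−p} z^{c₁} ∪ Γ̂_{ℙⁿ}`. -/
noncomputable def gammaLeadingTerm (n : ℕ) (z q : ℝ) : ℂ :=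
  (1 / (n.factorial : ℂ)) * iteratedDeriv n (gammaClassFunction n z q) 0

open ProbabilityTheory Filter Set

/-! ### Products of independent exponential variables -/

/-- The law of a product of `n + 1` independent exponential variables of rate `r`. -/
noncomputable def expProductLaw (r : ℝ) : ℕ → Measure ℝ
  | 0 => expMeasure r
  | n + 1 => expMeasure r ∗ₘ expProductLaw r n

lemma isProbabilityMeasure_expProductLaw {r : ℝ} (hr : 0 < r) (n : ℕ) :
    IsProbabilityMeasure (expProductLaw r n) := by
  have := isProbabilityMeasure_expMeasure hr
  induction n with
  | zero => exact this
  | succ n ih => rw [expProductLaw]; infer_instance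

lemma expMeasure_eq_withDensity_restrict (r : ℝ) :
    expMeasure r = (volume.restrict (Ioi 0)).withDensity
      fun x => ENNReal.ofReal (r * Real.exp (-(r * x))) := by
  rw [← withDensity_indicator measurableSet_Ioi]
  refine withDensity_congr_ae ?_
  filter_upwards [Measure.ae_ne volume (0 : ℝ)] with x hx
  change exponentialPDF r x = _
  rw [exponentialPDF_eq]
  rcases lt_or_gt_of_ne hx with h | h
  · simp [h.not_ge, h.le]
  · simp [h.le, h]

lemma ae_pos_expMeasure (r : ℝ) : ∀ᵐ x ∂expMeasure r, 0 < x := by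
  rw [expMeasure_eq_withDensity_restrict]
  exact (withDensity_absolutelyContinuous _ _).ae_le (ae_restrict_mem measurableSet_Ioi)

lemma ae_pos_prod {μ ν : Measure ℝ} [SFinite μ] [SFinite ν] (hμ : ∀ᵐ x ∂μ, 0 < x)
    (hν : ∀ᵐ x ∂ν, 0 < x) : ∀ᵐ p ∂μ.prod ν, 0 < p.1 ∧ 0 < p.2 :=
  (Measure.quasiMeasurePreserving_fst.ae hμ).and (Measure.quasiMeasurePreserving_snd.ae hν)

lemma ae_pos_expProductLaw {r : ℝ} (hr : 0 < r) (n : ℕ) : ∀ᵐ x ∂expProductLaw r n, 0 < x := by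
  have := isProbabilityMeasure_expMeasure hr
  induction n with
  | zero => exact ae_pos_expMeasure r
  | succ n ih =>
    have := isProbabilityMeasure_expProductLaw hr n
    rw [expProductLaw, Measure.mconv, ae_map_iff (by fun_prop) measurableSet_Ioi]
    filter_upwards [ae_pos_prod (ae_pos_expMeasure r) ih] with p hp using mul_pos hp.1 hp.2

lemma expMeasure_Ioi {r y : ℝ} (hr : 0 < r) (hy : 0 ≤ y) :
    expMeasure r (Ioi y) = ENNReal.ofReal (Real.exp (-(r * y))) := by
  have := isProbabilityMeasure_expMeasure hr
  rw [← compl_Iic, prob_compl_eq_one_sub measurableSet_Iic, ← ofReal_cdf,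
    cdf_expMeasure_eq hr, if_pos hy, ← ENNReal.ofReal_one, ← ENNReal.ofReal_sub]
  · simp
  · simp only [sub_nonneg, Real.exp_le_one_iff, Left.neg_nonpos_iff]
    positivity

lemma complexMGF_log_expMeasure {r : ℝ} (hr : 0 < r) {p : ℂ} (hp : -1 < p.re) :
    complexMGF Real.log (expMeasure r) p
      = Complex.exp (p * Real.log r⁻¹) * Complex.Gamma (1 + p) := by
  have hr' : (r : ℂ) ≠ 0 := by exact_mod_cast hr.ne'
  have key := Complex.integral_cpow_mul_exp_neg_mul_Ioi (a := 1 + p) (r := r)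
    (by simp; linarith) hr
  rw [complexMGF, expMeasure_eq_withDensity_restrict,
    integral_withDensity_eq_integral_toReal_smul (by fun_prop) (by simp)]
  have : ∫ x in Ioi (0 : ℝ), (ENNReal.ofReal (r * Real.exp (-(r * x)))).toReal •
      Complex.exp (p * Real.log x) =
      ∫ x in Ioi (0 : ℝ), (r : ℂ) * ((x : ℂ) ^ (1 + p - 1) * Complex.exp (-(r * x))) := by
    refine setIntegral_congr_fun measurableSet_Ioi fun x hx => ?_
    have hx : 0 < x := hx
    have hx' : (x : ℂ) ≠ 0 := by exact_mod_cast hx.ne'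
    rw [ENNReal.toReal_ofReal (by positivity), add_sub_cancel_left, Complex.cpow_def_of_ne_zero hx',
      Complex.ofReal_log hx.le, Complex.real_smul]
    push_cast
    ring_nf
  rw [this, integral_const_mul, key, ← mul_assoc]
  congr 1
  have h1 : (1 / r : ℂ) ≠ 0 := by simpa using hr'
  rw [Complex.cpow_add _ _ h1, Complex.cpow_one, ← mul_assoc, mul_one_div_cancel hr', one_mul,
    Complex.cpow_def_of_ne_zero h1, Complex.ofReal_log (by positivity)]
  push_cast
  rw [one_div, mul_comm]

lemma integrable_exp_mul_log_expMeasure {r t : ℝ} (hr : 0 < r) (ht : -1 < t) :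
    Integrable (fun x => Real.exp (t * Real.log x)) (expMeasure r) := by
  refine not_imp_comm.1 integral_undef ?_
  have h := complexMGF_log_expMeasure hr (p := (t : ℂ)) (by simpa using ht)
  rw [complexMGF_ofReal, mgf] at h
  intro h0
  rw [h0, Complex.ofReal_zero, eq_comm, mul_eq_zero] at h
  refine h.elim (Complex.exp_ne_zero _) (Complex.Gamma_ne_zero_of_re_pos ?_)
  simp
  linarith

lemma integrable_exp_mul_log_expProductLaw {r t : ℝ} (hr : 0 < r) (ht : -1 < t) (n : ℕ) :
    Integrable (fun x => Real.exp (t * Real.log x)) (expProductLaw r n) := by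
  have := isProbabilityMeasure_expMeasure hr
  induction n with
  | zero => exact integrable_exp_mul_log_expMeasure hr ht
  | succ n ih =>
    have := isProbabilityMeasure_expProductLaw hr n
    rw [expProductLaw, Measure.mconv, integrable_map_measure (by fun_prop) (by fun_prop)]
    refine ((integrable_exp_mul_log_expMeasure hr ht).mul_prod ih).congr ?_
    filter_upwards [ae_pos_prod (ae_pos_expMeasure r) (ae_pos_expProductLaw hr n)] with p hp
    rw [Function.comp_apply, Real.log_mul hp.1.ne' hp.2.ne', mul_add, Real.exp_add]

lemma complexMGF_log_expProductLaw {r : ℝ} (hr : 0 < r) (n : ℕ) {p : ℂ} (hp : -1 < p.re) :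
    complexMGF Real.log (expProductLaw r n) p
      = (Complex.exp (p * Real.log r⁻¹) * Complex.Gamma (1 + p)) ^ (n + 1) := by
  have := isProbabilityMeasure_expMeasure hr
  induction n with
  | zero => rw [zero_add, pow_one, expProductLaw, complexMGF_log_expMeasure hr hp]
  | succ n ih =>
    have := isProbabilityMeasure_expProductLaw hr n
    rw [pow_succ', ← ih, ← complexMGF_log_expMeasure hr hp, complexMGF, complexMGF, complexMGF,
      ← integral_prod_mul, expProductLaw, Measure.mconv,
      integral_map (by fun_prop) (by fun_prop)]
    refine integral_congr_ae ?_
    filter_upwards [ae_pos_prod (ae_pos_expMeasure r) (ae_pos_expProductLaw hr n)] with p hp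
    rw [Real.log_mul hp.1.ne' hp.2.ne', Complex.ofReal_add, mul_add, Complex.exp_add]

/-! ### Truncated powers of the logarithm -/

/-- The function `(log t)₊ⁿ / n!`, set to `0` for `t ≤ 1`. -/
noncomputable def truncLogPow (n : ℕ) (t : ℝ) : ℝ :=
  (Ioi 1).indicator (fun t => Real.log t ^ n / n.factorial) t

@[fun_prop]
lemma measurable_truncLogPow (n : ℕ) : Measurable (truncLogPow n) :=
  Measurable.indicator (by fun_prop) measurableSet_Ioi

lemma truncLogPow_nonneg (n : ℕ) (t : ℝ) : 0 ≤ truncLogPow n t := by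
  refine indicator_nonneg (fun t ht => ?_) t
  have := Real.log_nonneg (le_of_lt ht)
  positivity

lemma truncLogPow_of_one_lt {n : ℕ} {t : ℝ} (ht : 1 < t) :
    truncLogPow n t = Real.log t ^ n / n.factorial := indicator_of_mem ht _

lemma truncLogPow_of_le_one {n : ℕ} {t : ℝ} (ht : t ≤ 1) : truncLogPow n t = 0 :=
  indicator_of_notMem (by simpa using ht) _

lemma lintegral_truncLogPow_div (n : ℕ) {c x : ℝ} (hc : 0 < c) :
    ∫⁻ y in Ioo 0 x, ENNReal.ofReal (truncLogPow n (c * y) / y)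
      = ENNReal.ofReal (truncLogPow (n + 1) (c * x)) := by
  rcases le_or_gt (c * x) 1 with h | h
  · rw [truncLogPow_of_le_one h, ENNReal.ofReal_zero, setLIntegral_congr_fun (g := fun _ => 0)
      measurableSet_Ioo, lintegral_zero]
    intro y hy
    have : c * y ≤ 1 := (mul_le_mul_of_nonneg_left hy.2.le hc.le).trans h
    simp [truncLogPow_of_le_one this]
  have hcx : c⁻¹ < x := by rwa [inv_lt_iff_one_lt_mul₀' hc]
  have hc' : 0 < c⁻¹ := by positivity
  have hsplit : ∫⁻ y in Ioo 0 x, ENNReal.ofReal (truncLogPow n (c * y) / y)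
      = ∫⁻ y in Ioc c⁻¹ x, ENNReal.ofReal (Real.log (c * y) ^ n / n.factorial / y) := by
    rw [← setLIntegral_congr Ioo_ae_eq_Ioc, ← lintegral_indicator measurableSet_Ioo,
      ← lintegral_indicator measurableSet_Ioo]
    refine lintegral_congr fun y => ?_
    have hiff : c⁻¹ < y ↔ 1 < c * y := inv_lt_iff_one_lt_mul₀' hc
    by_cases hy : c⁻¹ < y
    · simp [indicator, hy, hc'.trans hy, truncLogPow_of_one_lt (hiff.1 hy)]
    · simp [indicator, hy, truncLogPow_of_le_one (not_lt.1 (hiff.not.1 hy))]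
  rw [hsplit, truncLogPow_of_one_lt h]
  have hderiv : ∀ y ∈ uIcc c⁻¹ x, HasDerivAt
      (fun y => Real.log (c * y) ^ (n + 1) / (n + 1).factorial)
      (Real.log (c * y) ^ n / n.factorial / y) y := by
    intro y hy
    rw [uIcc_of_le hcx.le] at hy
    have hy0 : 0 < y := hc'.trans_le hy.1
    have h1 := (((hasDerivAt_id y).const_mul c).log (mul_pos hc hy0).ne').pow (n + 1)
    refine (h1.div_const ((n + 1).factorial : ℝ)).congr_deriv ?_
    simp [Nat.factorial_succ]
    field_simp
  have hpos : ∀ y ∈ Icc c⁻¹ x, 0 < y ∧ 0 ≤ Real.log (c * y) := by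
    intro y hy
    refine ⟨hc'.trans_le hy.1, Real.log_nonneg ?_⟩
    rw [← mul_inv_cancel₀ hc.ne']
    exact mul_le_mul_of_nonneg_left hy.1 hc.le
  have hint : IntervalIntegrable (fun y => Real.log (c * y) ^ n / n.factorial / y) volume
      c⁻¹ x := by
    refine ContinuousOn.intervalIntegrable ?_
    rw [uIcc_of_le hcx.le]
    refine ContinuousOn.div (ContinuousOn.div_const (ContinuousOn.pow (ContinuousOn.log
      (by fun_prop) fun y hy => (mul_pos hc (hpos y hy).1).ne') _) _) (by fun_prop)
      fun y hy => (hpos y hy).1.ne'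
  have hftc := intervalIntegral.integral_eq_sub_of_hasDerivAt hderiv hint
  rw [intervalIntegral.integral_of_le hcx.le, mul_inv_cancel₀ hc.ne'] at hftc
  rw [← ofReal_integral_eq_lintegral_ofReal ((intervalIntegrable_iff_integrableOn_Ioc_of_le
    hcx.le).1 hint), hftc]
  · simp
  · filter_upwards [ae_restrict_mem measurableSet_Ioc] with y hy
    obtain ⟨h1, h2⟩ := hpos y (Ioc_subset_Icc_self hy)
    simp only [Pi.zero_apply]
    positivity

/-- Tonelli form of the integration by parts `∫ e^{-ry} φₙ(cy) dy/y = 𝔼[φₙ₊₁(c X)]`. -/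
lemma lintegral_exp_mul_truncLogPow {r c : ℝ} (hr : 0 < r) (hc : 0 < c) (n : ℕ) :
    ∫⁻ y in Ioi 0, ENNReal.ofReal (Real.exp (-(r * y)) / y) *
        ENNReal.ofReal (truncLogPow n (c * y))
      = ∫⁻ x, ENNReal.ofReal (truncLogPow (n + 1) (c * x)) ∂expMeasure r := by
  have := isProbabilityMeasure_expMeasure hr
  calc
    _ = ∫⁻ y in Ioi 0, (∫⁻ x, (Ioi y).indicator
          (fun _ => ENNReal.ofReal (truncLogPow n (c * y) / y)) x ∂expMeasure r) := by
      refine setLIntegral_congr_fun measurableSet_Ioi fun y hy => ?_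
      have hy : 0 < y := hy
      rw [lintegral_indicator_const measurableSet_Ioi, expMeasure_Ioi hr hy.le,
        ← ENNReal.ofReal_mul (by positivity), ← ENNReal.ofReal_mul' (Real.exp_nonneg _)]
      congr 1
      ring
    _ = ∫⁻ x, (∫⁻ y in Ioi 0, (Ioi y).indicator
          (fun _ => ENNReal.ofReal (truncLogPow n (c * y) / y)) x) ∂expMeasure r := by
      refine lintegral_lintegral_swap (Measurable.aemeasurable ?_)
      have h : MeasurableSet {p : ℝ × ℝ | p.1 < p.2} := measurableSet_lt (by fun_prop) (by fun_prop)
      exact Measurable.indicator (f := fun p : ℝ × ℝ =>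
        ENNReal.ofReal (truncLogPow n (c * p.1) / p.1)) (by fun_prop) h
    _ = _ := by
      refine lintegral_congr fun x => ?_
      rw [← lintegral_truncLogPow_div n hc, ← Iio_inter_Ioi,
        ← Measure.restrict_restrict measurableSet_Iio, ← lintegral_indicator measurableSet_Iio]
      rfl

/-! ### The oscillatory integral as an expectation -/

lemma lintegral_mirror_eq {r : ℝ} (hr : 0 < r) (n : ℕ) {q : ℝ} (hq : 0 < q) :
    ∫⁻ x, ENNReal.ofReal (Real.exp (-(r * (∑ i, x i + q / ∏ i, x i))) / ∏ i, x i)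
        ∂Measure.pi (fun _ : Fin n => volume.restrict (Ioi (0 : ℝ)))
      = ∫⁻ u, ENNReal.ofReal (truncLogPow n (u / q)) ∂expProductLaw r n := by
  have := isProbabilityMeasure_expMeasure hr
  induction n generalizing q with
  | zero =>
    have h (u : ℝ) : ENNReal.ofReal (truncLogPow 0 (u / q)) = (Ioi q).indicator (fun _ => 1) u := by
      by_cases hu : q < u
      · simp [hu, truncLogPow_of_one_lt ((one_lt_div hq).2 hu)]
      · simp [hu, truncLogPow_of_le_one ((div_le_one hq).2 (not_lt.1 hu))]
    simp_rw [h]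
    rw [lintegral_indicator_const measurableSet_Ioi, expProductLaw, expMeasure_Ioi hr hq.le,
      Measure.pi_of_empty, lintegral_dirac]
    simp
  | succ n ih =>
    have := isProbabilityMeasure_expProductLaw hr n
    rw [← ((measurePreserving_piFinSuccAbove
      (fun _ : Fin (n + 1) => volume.restrict (Ioi (0 : ℝ))) 0).symm).lintegral_comp (by fun_prop),
      lintegral_prod _ (Measurable.aemeasurable (by fun_prop))]
    calc
      _ = ∫⁻ y in Ioi 0, (∫⁻ u, ENNReal.ofReal (Real.exp (-(r * y)) / y) *
            ENNReal.ofReal (truncLogPow n (u / q * y)) ∂expProductLaw r n) := by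
        refine setLIntegral_congr_fun measurableSet_Ioi fun y hy => ?_
        have hy : 0 < y := hy
        have hu (u : ℝ) : u / q * y = u / (q / y) := by field_simp
        simp_rw [hu]
        rw [lintegral_const_mul _ (by fun_prop), ← ih (div_pos hq hy),
          ← lintegral_const_mul _ (by fun_prop)]
        refine lintegral_congr fun x => ?_
        rw [← ENNReal.ofReal_mul (by positivity)]
        congr 1
        simp [MeasurableEquiv.piFinSuccAbove, Fin.sum_univ_succ, Fin.prod_univ_succ]
        rw [div_mul_div_comm, ← Real.exp_add, div_div]
        congr 2
        ring
      _ = ∫⁻ u, (∫⁻ y in Ioi 0, ENNReal.ofReal (Real.exp (-(r * y)) / y) *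
            ENNReal.ofReal (truncLogPow n (u / q * y))) ∂expProductLaw r n :=
        lintegral_lintegral_swap (Measurable.aemeasurable (by fun_prop))
      _ = ∫⁻ u, (∫⁻ x, ENNReal.ofReal (truncLogPow (n + 1) (x * u / q)) ∂expMeasure r)
            ∂expProductLaw r n := by
        refine lintegral_congr_ae ?_
        filter_upwards [ae_pos_expProductLaw hr n] with u hu
        rw [lintegral_exp_mul_truncLogPow hr (div_pos hu hq)]
        refine lintegral_congr fun x => ?_
        rw [div_mul_eq_mul_div, mul_comm x]
      _ = _ := by
        rw [expProductLaw, Measure.lintegral_mconv (by fun_prop)]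
        exact lintegral_lintegral_swap (Measurable.aemeasurable (by fun_prop))

lemma mirrorOscIntegral_eq_integral_truncLogPow (n : ℕ) {z q : ℝ} (hz : 0 < z) (hq : 0 < q) :
    mirrorOscIntegral n z q = ∫ u, truncLogPow n (u / q) ∂expProductLaw z⁻¹ n := by
  rw [mirrorOscIntegral, integral_eq_lintegral_of_nonneg_ae _
      (Measurable.aestronglyMeasurable (by fun_prop)),
    integral_eq_lintegral_of_nonneg_ae (ae_of_all _ fun _ => truncLogPow_nonneg _ _)
      (Measurable.aestronglyMeasurable (by fun_prop)),
    ← lintegral_mirror_eq (inv_pos.2 hz) n hq, volume_pi, Measure.restrict_pi_pi]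
  · simp only [neg_div, inv_mul_eq_div]
  · refine (ae_restrict_iff' (MeasurableSet.univ_pi fun _ => measurableSet_Ioi)).2
      (ae_of_all _ fun x hx => ?_)
    have : 0 ≤ ∏ i, x i := Finset.prod_nonneg fun i _ => le_of_lt (hx i trivial)
    simp only [Pi.zero_apply]
    positivity

/-! ### The leading term as an expectation -/

lemma Ioi_subset_integrableExpSet_log_sub {r : ℝ} (hr : 0 < r) (n : ℕ) (a : ℝ) :
    Ioi (-1) ⊆ integrableExpSet (fun u => Real.log u - a) (expProductLaw r n) := by
  intro t ht
  refine ((integrable_exp_mul_log_expProductLaw hr ht n).mul_const (Real.exp (-(t * a)))).congr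
    (ae_of_all _ fun u => ?_)
  simp only [← Real.exp_add]
  ring_nf

lemma zero_mem_interior_integrableExpSet_log_sub {r : ℝ} (hr : 0 < r) (n : ℕ) (a : ℝ) :
    0 ∈ interior (integrableExpSet (fun u => Real.log u - a) (expProductLaw r n)) :=
  interior_mono (Ioi_subset_integrableExpSet_log_sub hr n a) (by simp)

lemma gammaClassFunction_eq_complexMGF (n : ℕ) {z q : ℝ} (hz : 0 < z) (hq : 0 < q) {p : ℂ}
    (hp : -1 < p.re) :
    gammaClassFunction n z q p
      = complexMGF (fun u => Real.log u - Real.log q) (expProductLaw z⁻¹ n) p := by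
  have h : complexMGF (fun u => Real.log u - Real.log q) (expProductLaw z⁻¹ n) p
      = complexMGF Real.log (expProductLaw z⁻¹ n) p * Complex.exp (-(p * Real.log q)) := by
    rw [complexMGF, complexMGF, ← integral_mul_const]
    refine integral_congr_ae (ae_of_all _ fun u => ?_)
    simp only [← Complex.exp_add]
    push_cast
    ring_nf
  rw [h, complexMGF_log_expProductLaw (inv_pos.2 hz) n hp, gammaClassFunction, mul_pow,
    ← Complex.exp_nat_mul, mul_right_comm, ← Complex.exp_add, inv_inv,
    Real.log_div (by positivity) hq.ne', Real.log_pow]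
  push_cast
  ring_nf

lemma gammaLeadingTerm_eq_integral (n : ℕ) {z q : ℝ} (hz : 0 < z) (hq : 0 < q) :
    gammaLeadingTerm n z q
      = ((∫ u, (Real.log u - Real.log q) ^ n / n.factorial ∂expProductLaw z⁻¹ n : ℝ) : ℂ) := by
  have hev : gammaClassFunction n z q =ᶠ[nhds 0]
      complexMGF (fun u => Real.log u - Real.log q) (expProductLaw z⁻¹ n) := by
    have : ∀ᶠ p : ℂ in nhds 0, -1 < p.re :=
      Complex.continuous_re.continuousAt.eventually (lt_mem_nhds (by simp))
    filter_upwards [this] with p hp using gammaClassFunction_eq_complexMGF n hz hq hp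
  rw [gammaLeadingTerm, hev.iteratedDeriv_eq, iteratedDeriv_complexMGF
    (by simpa using zero_mem_interior_integrableExpSet_log_sub (inv_pos.2 hz) n _),
    ← integral_complex_ofReal, ← integral_const_mul]
  refine integral_congr_ae (ae_of_all _ fun u => ?_)
  simp [div_eq_inv_mul]

/-! ### Comparison -/

lemma abs_truncLogPow_sub_le (n : ℕ) {u q : ℝ} (hu : 0 < u) (hq : 0 < q) :
    |truncLogPow n (u / q) - (Real.log u - Real.log q) ^ n / n.factorial|
      ≤ 2 ^ n * Real.exp (2⁻¹ * Real.log q) * Real.exp (-2⁻¹ * Real.log u) := by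
  rw [← Real.log_div hu.ne' hq.ne']
  rcases lt_or_ge 1 (u / q) with h | h
  · rw [truncLogPow_of_one_lt h, sub_self, abs_zero]
    positivity
  · have hlog : 0 ≤ -Real.log (u / q) := neg_nonneg.2 (Real.log_nonpos (by positivity) h)
    have hexp := Real.pow_div_factorial_le_exp (-Real.log (u / q) / 2) (by positivity) n
    rw [truncLogPow_of_le_one h, zero_sub, abs_neg, abs_div, abs_pow, ← abs_neg, abs_of_nonneg hlog,
      Nat.abs_cast, mul_assoc, ← Real.exp_add]
    calc
      _ = 2 ^ n * ((-Real.log (u / q) / 2) ^ n / n.factorial) := by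
        rw [div_pow]; field_simp
      _ ≤ 2 ^ n * Real.exp (-Real.log (u / q) / 2) := by gcongr
      _ = _ := by rw [Real.log_div hu.ne' hq.ne']; ring_nf

lemma abs_mirrorOscIntegral_sub_le (n : ℕ) {z q : ℝ} (hz : 0 < z) (hq : 0 < q) :
    ‖(mirrorOscIntegral n z q : ℂ) - gammaLeadingTerm n z q‖
      ≤ 2 ^ n * √q * ∫ u, Real.exp (-2⁻¹ * Real.log u) ∂expProductLaw z⁻¹ n := by
  have hr : 0 < z⁻¹ := inv_pos.2 hz
  have hbound : ∀ᵐ u ∂expProductLaw z⁻¹ n,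
      ‖truncLogPow n (u / q) - (Real.log u - Real.log q) ^ n / n.factorial‖
        ≤ 2 ^ n * √q * Real.exp (-2⁻¹ * Real.log u) := by
    filter_upwards [ae_pos_expProductLaw hr n] with u hu
    rw [Real.sqrt_eq_rpow, Real.rpow_def_of_pos hq, one_div, mul_comm (Real.log q)]
    exact abs_truncLogPow_sub_le n hu hq
  have hint := (integrable_exp_mul_log_expProductLaw hr (t := -2⁻¹) (by norm_num) n).const_mul
    (2 ^ n * √q)
  have hpow : Integrable (fun u => (Real.log u - Real.log q) ^ n / n.factorial)
      (expProductLaw z⁻¹ n) :=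
    (integrable_pow_of_mem_interior_integrableExpSet
      (zero_mem_interior_integrableExpSet_log_sub hr n _) n).div_const _
  have hdiff : Integrable (fun u => truncLogPow n (u / q)
      - (Real.log u - Real.log q) ^ n / n.factorial) (expProductLaw z⁻¹ n) :=
    hint.mono' (Measurable.aestronglyMeasurable (by fun_prop)) hbound
  have htrunc : Integrable (fun u => truncLogPow n (u / q)) (expProductLaw z⁻¹ n) :=
    (hdiff.add hpow).congr (ae_of_all _ fun u => by simp)
  rw [mirrorOscIntegral_eq_integral_truncLogPow n hz hq, gammaLeadingTerm_eq_integral n hz hq,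
    ← Complex.ofReal_sub, Complex.norm_real, ← integral_sub htrunc hpow, ← integral_const_mul]
  exact norm_integral_le_of_norm_le hint hbound

/-- the mirror-symmetric Gamma asymptotics for `ℙⁿ`:
`F_{n,z}(q) − M_{n,z}(q) → 0` as `q → 0⁺`. -/
theorem mirrorOscIntegral_gamma_asymptotics (n : ℕ) (hn : 1 ≤ n) (z : ℝ) (hz : 0 < z) :
    Filter.Tendsto (fun q : ℝ => (mirrorOscIntegral n z q : ℂ) - gammaLeadingTerm n z q)
      (nhdsWithin 0 (Set.Ioi (0 : ℝ))) (nhds 0) := by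
  set C : ℝ := ∫ u, Real.exp (-2⁻¹ * Real.log u) ∂expProductLaw z⁻¹ n
  refine squeeze_zero_norm' (a := fun q => 2 ^ n * √q * C) ?_ ?_
  · filter_upwards [self_mem_nhdsWithin] with q hq using abs_mirrorOscIntegral_sub_le n hz hq
  · have h : Continuous fun q : ℝ => 2 ^ n * √q * C := by fun_prop
    simpa using (h.tendsto 0).mono_left nhdsWithin_le_nhds
end

section
/- Let z > 0 be a real number and let γ denote the Euler–Mascheroni constant. Then the mirror oscillatory integral of ℙ² satisfies lim_{q→0⁺} ( ∫_{(0,∞)²} exp(−(x + y + q/(xy))/z) dx dy/(xy) − ( (log(z³/q) − 3γ)²/2 + π²/4 ) ) = 0. -/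
open MeasureTheory ProbabilityTheory
open scoped Real

instance : IsProbabilityMeasure (expMeasure 1) := isProbabilityMeasure_expMeasure one_pos

lemma expMeasure_one_eq_withDensity :
    expMeasure 1 = (volume.restrict (Set.Ioi (0 : ℝ))).withDensity
      fun t => ENNReal.ofReal (Real.exp (-t)) := by
  rw [restrict_Ioi_eq_restrict_Ici, expMeasure, gammaMeasure,
    ← withDensity_indicator measurableSet_Ici]
  congr 1
  funext t
  simp [gammaPDF_eq, Set.indicator_apply, apply_ite ENNReal.ofReal]

lemma expMeasure_one_Ioi {a : ℝ} (ha : 0 ≤ a) :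
    expMeasure 1 (Set.Ioi a) = ENNReal.ofReal (Real.exp (-a)) := by
  rw [expMeasure_one_eq_withDensity, withDensity_apply _ measurableSet_Ioi,
    Measure.restrict_restrict measurableSet_Ioi, Set.inter_eq_left.2 (Set.Ioi_subset_Ioi ha),
    ← ofReal_integral_eq_lintegral_ofReal (integrableOn_exp_neg_Ioi a)
      (Filter.Eventually.of_forall fun t => (Real.exp_pos _).le), integral_exp_neg_Ioi]

lemma ae_expMeasure_one_pos : ∀ᵐ t ∂expMeasure 1, 0 < t := by
  rw [expMeasure_one_eq_withDensity]
  exact (withDensity_absolutelyContinuous _ _).ae_le (ae_restrict_mem measurableSet_Ioi)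

lemma integrable_expMeasure_one_iff {g : ℝ → ℝ} :
    Integrable g (expMeasure 1) ↔
      IntegrableOn (fun t => Real.exp (-t) * g t) (Set.Ioi 0) := by
  rw [expMeasure_one_eq_withDensity, integrable_withDensity_iff_integrable_smul' (by fun_prop)
    (by simp)]
  simp [IntegrableOn, ENNReal.toReal_ofReal (Real.exp_pos _).le]

lemma integral_expMeasure_one (g : ℝ → ℝ) :
    ∫ t, g t ∂expMeasure 1 = ∫ t in Set.Ioi 0, Real.exp (-t) * g t := by
  rw [expMeasure_one_eq_withDensity, integral_withDensity_eq_integral_toReal_smul (by fun_prop)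
    (by simp)]
  simp [ENNReal.toReal_ofReal (Real.exp_pos _).le]

lemma Ioi_subset_integrableExpSet_log :
    Set.Ioi (-1) ⊆ integrableExpSet Real.log (expMeasure 1) := by
  intro s hs
  rw [integrableExpSet, Set.mem_ofPred_eq, integrable_expMeasure_one_iff]
  refine (Real.GammaIntegral_convergent (s := s + 1) (by grind)).congr_fun
    (fun t ht => ?_) measurableSet_Ioi
  simp only [add_sub_cancel_right, Real.rpow_def_of_pos ht, mul_comm s]

lemma zero_mem_interior_integrableExpSet_log :
    (0 : ℝ) ∈ interior (integrableExpSet Real.log (expMeasure 1)) :=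
  interior_mono Ioi_subset_integrableExpSet_log (by simp)

lemma mgf_log_expMeasure_one {s : ℝ} (hs : -1 < s) :
    mgf Real.log (expMeasure 1) s = Real.Gamma (s + 1) := by
  rw [mgf, integral_expMeasure_one, Real.Gamma_eq_integral (by linarith)]
  refine setIntegral_congr_fun measurableSet_Ioi fun t ht => ?_
  simp only [add_sub_cancel_right, Real.rpow_def_of_pos ht, mul_comm s]

lemma memLp_log_expMeasure_one : MemLp Real.log 2 (expMeasure 1) :=
  memLp_of_mem_interior_integrableExpSet zero_mem_interior_integrableExpSet_log 2

lemma integral_log_expMeasure_one :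
    ∫ t, Real.log t ∂expMeasure 1 = -Real.eulerMascheroniConstant := by
  rw [← deriv_mgf_zero zero_mem_interior_integrableExpSet_log]
  have h : mgf Real.log (expMeasure 1) =ᶠ[nhds 0] fun s => Real.Gamma (s + 1) := by
    filter_upwards [Ioi_mem_nhds (show (-1 : ℝ) < 0 by norm_num)] with s hs
    exact mgf_log_expMeasure_one hs
  rw [h.deriv_eq, deriv_comp_add_const, zero_add, Real.hasDerivAt_Gamma_one.deriv]

lemma Real.Gamma_add_one_mul_Gamma_one_sub_mul_sin {s : ℝ} (hs : -1 < s) (hs' : s < 1) :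
    Real.Gamma (s + 1) * Real.Gamma (-s + 1) * Real.sin (π * s) = π * s := by
  rcases eq_or_ne s 0 with rfl | h0
  · simp
  · have hsin : Real.sin (π * s) ≠ 0 := by
      intro h
      obtain ⟨n, hn⟩ := Real.sin_eq_zero_iff.1 h
      have hn' : (n : ℝ) = s := by
        have := Real.pi_ne_zero
        apply mul_left_cancel₀ this
        linarith
      rw [← hn'] at hs hs' h0
      norm_cast at hs hs' h0
      grind
    rw [Real.Gamma_add_one h0, neg_add_eq_sub, mul_assoc s,
      Real.Gamma_mul_Gamma_one_sub, mul_assoc, div_mul_cancel₀ _ hsin, mul_comm]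

lemma iteratedDeriv_two_sub_sq_of_reflection {f : ℝ → ℝ} (hf : ContDiffAt ℝ 3 f 0)
    (hf0 : f 0 = 1)
    (h : (fun s => f s * f (-s) * Real.sin (π * s)) =ᶠ[nhds 0] fun s => π * s) :
    iteratedDeriv 2 f 0 - deriv f 0 ^ 2 = π ^ 2 / 6 := by
  have hneg : ContDiffAt ℝ 3 (fun s => f (-s)) 0 := by
    apply ContDiffAt.comp
    · simpa using hf
    · fun_prop
  have hsin : ContDiffAt ℝ 3 (fun s => Real.sin (π * s)) 0 := by fun_prop
  have key := h.iteratedDeriv_eq 3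
  have hs (n : ℕ) : iteratedDeriv n (fun s => Real.sin (π * s)) 0
      = π ^ n * iteratedDeriv n Real.sin 0 := by
    rw [iteratedDeriv_comp_const_mul Real.contDiff_sin]; simp
  have hprod : ContDiffAt ℝ 3 (f * fun s => f (-s)) 0 := hf.mul hneg
  have e3 := iteratedDeriv_mul (n := 3) hprod hsin
  have e2 := iteratedDeriv_mul (n := 2) (hf.of_le (by norm_num)) (hneg.of_le (by norm_num))
  have hlin : iteratedDeriv 3 (fun s : ℝ => π * s) 0 = 0 := by
    simp [iteratedDeriv_succ]
  have hnf (n : ℕ) := iteratedDeriv_comp_neg n f 0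
  change iteratedDeriv 3 (f * (fun s => f (-s)) * (fun s => Real.sin (π * s))) 0 = _ at key
  rw [e3, hlin] at key
  simp [Finset.sum_range_succ, hs, e2, hnf, hf0] at key
  apply mul_left_cancel₀ Real.pi_ne_zero
  linarith

lemma variance_log_expMeasure_one : Var[Real.log; expMeasure 1] = π ^ 2 / 6 := by
  have h0 := zero_mem_interior_integrableExpSet_log
  rw [variance_eq_sub memLp_log_expMeasure_one]
  rw [← iteratedDeriv_mgf_zero h0, ← deriv_mgf_zero h0]
  refine iteratedDeriv_two_sub_sq_of_reflection (analyticAt_mgf h0).contDiffAt (by simp) ?_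
  filter_upwards [Ioo_mem_nhds (show (-1 : ℝ) < 0 by norm_num) one_pos] with s hs
  rw [mgf_log_expMeasure_one hs.1, mgf_log_expMeasure_one (by linarith [hs.2])]
  exact Real.Gamma_add_one_mul_Gamma_one_sub_mul_sin hs.1 hs.2

/-- The joint law of three independent standard exponential variables. -/
noncomputable def expMeasureCube : Measure (ℝ × ℝ × ℝ) :=
  (expMeasure 1).prod ((expMeasure 1).prod (expMeasure 1))

instance : IsProbabilityMeasure expMeasureCube := by
  unfold expMeasureCube; infer_instance

/-- The sum of the logarithms of the three coordinates. -/
noncomputable def sumLog (w : ℝ × ℝ × ℝ) : ℝ :=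
  Real.log w.1 + (Real.log w.2.1 + Real.log w.2.2)

lemma measurable_sumLog : Measurable sumLog := by
  unfold sumLog; fun_prop

lemma memLp_log_add_log_expMeasure_one :
    MemLp (fun w : ℝ × ℝ => Real.log w.1 + Real.log w.2) 2
      ((expMeasure 1).prod (expMeasure 1)) :=
  (memLp_log_expMeasure_one.comp_fst _).add (memLp_log_expMeasure_one.comp_snd _)

lemma memLp_sumLog : MemLp sumLog 2 expMeasureCube :=
  (memLp_log_expMeasure_one.comp_fst _).add (memLp_log_add_log_expMeasure_one.comp_snd _)

lemma variance_sumLog : Var[sumLog; expMeasureCube] = π ^ 2 / 2 := by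
  have h := variance_add_prod memLp_log_expMeasure_one memLp_log_add_log_expMeasure_one
  rw [variance_add_prod memLp_log_expMeasure_one memLp_log_expMeasure_one,
    variance_log_expMeasure_one] at h
  calc Var[sumLog; expMeasureCube] = _ := h
    _ = π ^ 2 / 2 := by ring

lemma integral_sumLog :
    ∫ w, sumLog w ∂expMeasureCube = -3 * Real.eulerMascheroniConstant := by
  have hi : Integrable Real.log (expMeasure 1) := memLp_log_expMeasure_one.integrable one_le_two
  unfold sumLog expMeasureCube
  have hi₂ : Integrable (fun w : ℝ × ℝ => Real.log w.1 + Real.log w.2)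
      ((expMeasure 1).prod (expMeasure 1)) := (hi.comp_fst _).add (hi.comp_snd _)
  rw [integral_add (hi.comp_fst _) (hi₂.comp_snd _), integral_fun_fst,
    integral_fun_snd (fun w : ℝ × ℝ => Real.log w.1 + Real.log w.2),
    integral_add (hi.comp_fst _) (hi.comp_snd _), integral_fun_fst, integral_fun_snd]
  simp only [integral_log_expMeasure_one, probReal_univ, one_smul]
  ring

lemma integral_add_sumLog_sq (L : ℝ) :
    ∫ w, (L + sumLog w) ^ 2 ∂expMeasureCube =
      (L - 3 * Real.eulerMascheroniConstant) ^ 2 + π ^ 2 / 2 := by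
  have hi := memLp_sumLog.integrable one_le_two
  have hL : MemLp (fun w => L + sumLog w) 2 expMeasureCube := (memLp_const L).add memLp_sumLog
  have h := variance_eq_sub hL
  rw [variance_const_add memLp_sumLog.aestronglyMeasurable, variance_sumLog,
    integral_add (integrable_const L) hi, integral_sumLog] at h
  simp at h
  linarith

lemma integrable_add_sumLog_sq (L : ℝ) :
    Integrable (fun w => (L + sumLog w) ^ 2) expMeasureCube :=
  ((memLp_const L).add memLp_sumLog).integrable_sq

lemma integrable_max_add_sumLog_sq (L : ℝ) :
    Integrable (fun w => (max (L + sumLog w) 0) ^ 2 / 2) expMeasureCube := by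
  have hm := measurable_sumLog
  refine (integrable_add_sumLog_sq L).mono' (by fun_prop) (Filter.Eventually.of_forall fun w => ?_)
  rw [Real.norm_of_nonneg (by positivity)]
  rcases le_total (L + sumLog w) 0 with h | h
  · rw [max_eq_right h]; nlinarith
  · rw [max_eq_left h]; nlinarith

open Filter in
lemma tendsto_integral_max_sub :
    Tendsto (fun L : ℝ => ∫ w, (max (L + sumLog w) 0) ^ 2 / 2 ∂expMeasureCube -
      ((L - 3 * Real.eulerMascheroniConstant) ^ 2 / 2 + π ^ 2 / 4)) atTop (nhds 0) := by
  have hm := measurable_sumLog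
  have key : ∀ L : ℝ, ∫ w, (max (L + sumLog w) 0) ^ 2 / 2 ∂expMeasureCube -
      ((L - 3 * Real.eulerMascheroniConstant) ^ 2 / 2 + π ^ 2 / 4) =
      ∫ w, -((min (L + sumLog w) 0) ^ 2 / 2) ∂expMeasureCube := by
    intro L
    have hL := integrable_add_sumLog_sq L
    have h2 : (L - 3 * Real.eulerMascheroniConstant) ^ 2 / 2 + π ^ 2 / 4 =
        ∫ w, (L + sumLog w) ^ 2 / 2 ∂expMeasureCube := by
      rw [integral_div, integral_add_sumLog_sq]; ring
    rw [h2, ← integral_sub (integrable_max_add_sumLog_sq L) (hL.div_const 2)]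
    congr 1 with w
    rcases le_total (L + sumLog w) 0 with h | h <;> simp [h]
  simp only [key]
  rw [show nhds (0 : ℝ) = nhds (∫ _, (0 : ℝ) ∂expMeasureCube) by simp]
  refine tendsto_integral_filter_of_dominated_convergence (fun w => sumLog w ^ 2)
    (Eventually.of_forall fun L => by fun_prop) ?_ memLp_sumLog.integrable_sq ?_
  · filter_upwards [eventually_ge_atTop 0] with L hL
    refine Eventually.of_forall fun w => ?_
    rw [norm_neg, Real.norm_of_nonneg (by positivity)]
    rcases le_total (L + sumLog w) 0 with h | h
    · rw [min_eq_left h]; nlinarith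
    · rw [min_eq_right h]; nlinarith
  · refine Eventually.of_forall fun w => tendsto_const_nhds.congr' ?_
    filter_upwards [eventually_ge_atTop (-sumLog w)] with L hL
    rw [min_eq_right (by linarith)]; simp

lemma lintegral_Ioo_ofReal_deriv {f f' : ℝ → ℝ} {a b : ℝ} (hab : a ≤ b)
    (hf : ∀ x ∈ Set.Icc a b, HasDerivAt f (f' x) x) (hf' : ContinuousOn f' (Set.Icc a b))
    (hpos : ∀ x ∈ Set.Ioo a b, 0 ≤ f' x) :
    ∫⁻ x in Set.Ioo a b, ENNReal.ofReal (f' x) = ENNReal.ofReal (f b - f a) := by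
  have hint : IntegrableOn f' (Set.Ioo a b) :=
    (hf'.integrableOn_Icc).mono_set Set.Ioo_subset_Icc_self
  rw [← ofReal_integral_eq_lintegral_ofReal hint
    ((ae_restrict_iff' measurableSet_Ioo).2 (Filter.Eventually.of_forall hpos)),
    ← integral_Ioc_eq_integral_Ioo, ← intervalIntegral.integral_of_le hab,
    intervalIntegral.integral_eq_sub_of_hasDerivAt (by rwa [Set.uIcc_of_le hab])
      (by apply ContinuousOn.intervalIntegrable; rwa [Set.uIcc_of_le hab])]

lemma lintegral_Ioo_ofReal_inv {a b : ℝ} (ha : 0 < a) (hb : 0 < b) :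
    ∫⁻ x in Set.Ioo a b, ENNReal.ofReal x⁻¹ = ENNReal.ofReal (Real.log b - Real.log a) := by
  rcases le_total a b with hab | hab
  · have hne : ∀ x ∈ Set.Icc a b, x ≠ 0 := fun x hx => (ha.trans_le hx.1).ne'
    exact lintegral_Ioo_ofReal_deriv hab (fun x hx => Real.hasDerivAt_log (hne x hx))
      (continuousOn_id.inv₀ hne) fun x hx => (inv_pos.2 (ha.trans hx.1)).le
  · rw [Set.Ioo_eq_empty_of_le hab, ENNReal.ofReal_of_nonpos
      (sub_nonpos.2 (Real.log_le_log hb hab))]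
    simp

lemma lintegral_Ioo_zero_ofReal_log_sub_mul_inv {a b : ℝ} (ha : 0 < a) (hb : 0 < b) :
    ∫⁻ x in Set.Ioo 0 b, ENNReal.ofReal (Real.log x - Real.log a) * ENNReal.ofReal x⁻¹ =
      ENNReal.ofReal ((max (Real.log b - Real.log a) 0) ^ 2 / 2) := by
  rcases le_total a b with hab | hab
  · have hne : ∀ x ∈ Set.Icc a b, x ≠ 0 := fun x hx => (ha.trans_le hx.1).ne'
    have hnn : ∀ x, a ≤ x → 0 ≤ Real.log x - Real.log a :=
      fun x hx => sub_nonneg.2 (Real.log_le_log ha hx)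
    have hzero : ∫⁻ x in Set.Ioo 0 b \ Set.Ioo a b,
        ENNReal.ofReal (Real.log x - Real.log a) * ENNReal.ofReal x⁻¹ = 0 := by
      rw [← lintegral_zero (μ := volume.restrict (Set.Ioo 0 b \ Set.Ioo a b))]
      refine setLIntegral_congr_fun (measurableSet_Ioo.diff measurableSet_Ioo) fun x hx => ?_
      have hxa : x ≤ a := by by_contra! h; exact hx.2 ⟨h, hx.1.2⟩
      rw [ENNReal.ofReal_of_nonpos (sub_nonpos.2 (Real.log_le_log hx.1.1 hxa)), zero_mul]
    rw [← lintegral_inter_add_sdiff _ (Set.Ioo 0 b) (measurableSet_Ioo (a := a) (b := b)), hzero,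
      add_zero, Set.inter_eq_right.2 (Set.Ioo_subset_Ioo_left ha.le), max_eq_left (hnn b hab)]
    have hd := lintegral_Ioo_ofReal_deriv (f := fun x => (Real.log x - Real.log a) ^ 2 / 2)
      (f' := fun x => (Real.log x - Real.log a) * x⁻¹) hab
      (fun x hx => by
        refine ((((Real.hasDerivAt_log (hne x hx)).sub_const _).pow 2).div_const 2).congr_deriv ?_
        simp; ring)
      (((Real.continuousOn_log.mono hne).sub continuousOn_const).mul
        (continuousOn_id.inv₀ hne))
      (fun x hx => mul_nonneg (hnn x hx.1.le) (inv_pos.2 (ha.trans hx.1)).le)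
    simp only [sub_self, ne_eq, OfNat.ofNat_ne_zero, not_false_eq_true, zero_pow, zero_div,
      sub_zero] at hd
    rw [← hd]
    exact setLIntegral_congr_fun measurableSet_Ioo fun x hx =>
      (ENNReal.ofReal_mul (hnn x hx.1.le)).symm
  · rw [max_eq_right (sub_nonpos.2 (Real.log_le_log hb hab))]
    simp only [ne_eq, OfNat.ofNat_ne_zero, not_false_eq_true, zero_pow, zero_div,
      ENNReal.ofReal_zero]
    rw [← lintegral_zero (μ := volume.restrict (Set.Ioo 0 b))]
    refine setLIntegral_congr_fun measurableSet_Ioo fun x hx => ?_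
    rw [ENNReal.ofReal_of_nonpos
      (sub_nonpos.2 (Real.log_le_log hx.1 (hx.2.le.trans hab))), zero_mul]

/-- The kernel `1 / (x y)` cut off to the points lying below `w` in the mirror coordinates. -/
noncomputable def cutoffKernel (z q x y : ℝ) (w : ℝ × ℝ × ℝ) : ENNReal :=
  (Set.Ioi (x / z) ×ˢ Set.Ioi (y / z) ×ˢ Set.Ioi (q / (x * y) / z)).indicator
    (fun _ => ENNReal.ofReal x⁻¹ * ENNReal.ofReal y⁻¹) w

lemma measurable_cutoffKernel (z q : ℝ) :
    Measurable fun p : ℝ × ℝ × ℝ × ℝ × ℝ => cutoffKernel z q p.1 p.2.1 p.2.2 := by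
  have hs : MeasurableSet {p : ℝ × ℝ × ℝ × ℝ × ℝ | p.1 / z < p.2.2.1 ∧ p.2.1 / z < p.2.2.2.1 ∧
      q / (p.1 * p.2.1) / z < p.2.2.2.2} := by
    measurability
  exact Measurable.indicator (f := fun p : ℝ × ℝ × ℝ × ℝ × ℝ =>
    ENNReal.ofReal p.1⁻¹ * ENNReal.ofReal p.2.1⁻¹) (by fun_prop) hs

lemma lintegral_cutoffKernel_expMeasureCube {z q x y : ℝ} (hz : 0 < z) (hq : 0 < q)
    (hx : 0 < x) (hy : 0 < y) :
    ∫⁻ w, cutoffKernel z q x y w ∂expMeasureCube =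
      ENNReal.ofReal (Real.exp (-(x + y + q / (x * y)) / z) / (x * y)) := by
  unfold cutoffKernel
  rw [lintegral_indicator_const (measurableSet_Ioi.prod (measurableSet_Ioi.prod measurableSet_Ioi)),
    expMeasureCube, Measure.prod_prod, Measure.prod_prod, expMeasure_one_Ioi (by positivity),
    expMeasure_one_Ioi (by positivity), expMeasure_one_Ioi (by positivity),
    ← ENNReal.ofReal_mul (by positivity), ← ENNReal.ofReal_mul (by positivity),
    ← ENNReal.ofReal_mul (by positivity), ← ENNReal.ofReal_mul (by positivity),
    ← Real.exp_add, ← Real.exp_add]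
  congr 1
  rw [div_eq_inv_mul (Real.exp _), mul_inv]
  congr 2
  ring

lemma lintegral_lintegral_cutoffKernel {z q : ℝ} (hz : 0 < z) (hq : 0 < q) {w : ℝ × ℝ × ℝ}
    (h1 : 0 < w.1) (h2 : 0 < w.2.1) (h3 : 0 < w.2.2) :
    ∫⁻ x in Set.Ioi 0, ∫⁻ y in Set.Ioi 0, cutoffKernel z q x y w =
      ENNReal.ofReal ((max (Real.log (z ^ 3 / q) + sumLog w) 0) ^ 2 / 2) := by
  obtain ⟨a, b, c⟩ := w
  dsimp only at h1 h2 h3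
  have inner : ∀ x ∈ Set.Ioi (0 : ℝ), ∫⁻ y in Set.Ioi 0, cutoffKernel z q x y (a, b, c) =
      (Set.Ioo 0 (z * a)).indicator (fun x =>
        ENNReal.ofReal (Real.log x - Real.log (q / (z ^ 2 * b * c))) * ENNReal.ofReal x⁻¹) x := by
    intro x hx
    have hx : 0 < x := hx
    by_cases hxa : x < z * a
    · rw [Set.indicator_of_mem (show x ∈ Set.Ioo 0 (z * a) from ⟨hx, hxa⟩)]
      have hlog : Real.log x - Real.log (q / (z ^ 2 * b * c)) =
          Real.log (z * b) - Real.log (q / (x * z * c)) := by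
        rw [← Real.log_div (by positivity) (by positivity),
          ← Real.log_div (by positivity) (by positivity)]
        congr 1
        field_simp
      rw [hlog, ← lintegral_Ioo_ofReal_inv (by positivity) (by positivity), mul_comm,
        ← lintegral_const_mul _ (by fun_prop), ← lintegral_indicator measurableSet_Ioi,
        ← lintegral_indicator measurableSet_Ioo]
      congr 1 with y
      have hiff : (0 < y ∧ x / z < a ∧ y / z < b ∧ q / (x * y) / z < c) ↔
          (q / (x * z * c) < y ∧ y < z * b) := by
        rw [div_lt_iff₀' hz, div_lt_iff₀' hz]
        constructor
        · rintro ⟨hy, -, hyb, hyc⟩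
          refine ⟨?_, hyb⟩
          rw [div_div, div_lt_iff₀ (by positivity)] at hyc
          rw [div_lt_iff₀ (by positivity)]
          linarith
        · rintro ⟨hyc, hyb⟩
          have hy : 0 < y := lt_trans (by positivity) hyc
          refine ⟨hy, hxa, hyb, ?_⟩
          rw [div_lt_iff₀ (by positivity)] at hyc
          rw [div_div, div_lt_iff₀ (by positivity)]
          linarith
      simp only [cutoffKernel, Set.indicator_apply, Set.mem_prod, Set.mem_Ioi, Set.mem_Ioo,
        ← ite_and, hiff]
    · rw [Set.indicator_of_notMem (by simp [hxa]), ← lintegral_zero]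
      congr 1 with y
      rw [cutoffKernel, Set.indicator_of_notMem]
      simp [div_lt_iff₀' hz, hxa]
  rw [setLIntegral_congr_fun measurableSet_Ioi inner, setLIntegral_indicator measurableSet_Ioo,
    Set.inter_eq_left.2 Set.Ioo_subset_Ioi_self,
    lintegral_Ioo_zero_ofReal_log_sub_mul_inv (by positivity) (by positivity)]
  congr 4
  rw [sumLog, ← Real.log_div (by positivity) (by positivity), ← Real.log_mul h2.ne' h3.ne',
    ← Real.log_mul h1.ne' (by positivity), ← Real.log_mul (by positivity) (by positivity)]
  congr 1
  field_simp

lemma ae_expMeasureCube_pos : ∀ᵐ w ∂expMeasureCube, 0 < w.1 ∧ 0 < w.2.1 ∧ 0 < w.2.2 := by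
  have h := ae_expMeasure_one_pos
  have h1 : ∀ᵐ w ∂expMeasureCube, 0 < w.1 := Measure.quasiMeasurePreserving_fst.ae h
  have h2 : ∀ᵐ v ∂(expMeasure 1).prod (expMeasure 1), 0 < v.1 ∧ 0 < v.2 :=
    (Measure.quasiMeasurePreserving_fst.ae h).and (Measure.quasiMeasurePreserving_snd.ae h)
  exact h1.and (Measure.quasiMeasurePreserving_snd.ae h2)

lemma lintegral_mirror_eq_s11 {z q : ℝ} (hz : 0 < z) (hq : 0 < q) :
    ∫⁻ x in Set.Ioi 0, ∫⁻ y in Set.Ioi 0,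
        ENNReal.ofReal (Real.exp (-(x + y + q / (x * y)) / z) / (x * y)) =
      ∫⁻ w, ENNReal.ofReal ((max (Real.log (z ^ 3 / q) + sumLog w) 0) ^ 2 / 2)
        ∂expMeasureCube := by
  have hK := measurable_cutoffKernel z q
  have hswap : ∀ x, ∫⁻ y in Set.Ioi 0, ∫⁻ w, cutoffKernel z q x y w ∂expMeasureCube =
      ∫⁻ w, (∫⁻ y in Set.Ioi 0, cutoffKernel z q x y w) ∂expMeasureCube := fun x =>
    lintegral_lintegral_swap (f := cutoffKernel z q x)
      (hK.comp (measurable_const.prodMk measurable_id)).aemeasurable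
  have hmeas : Measurable (Function.uncurry fun (x : ℝ) (w : ℝ × ℝ × ℝ) =>
      ∫⁻ y in Set.Ioi 0, cutoffKernel z q x y w) :=
    Measurable.lintegral_prod_right' (f := fun p : (ℝ × ℝ × ℝ × ℝ) × ℝ =>
      cutoffKernel z q p.1.1 p.2 p.1.2)
      (hK.comp (f := fun p : (ℝ × ℝ × ℝ × ℝ) × ℝ => (p.1.1, p.2, p.1.2)) (by fun_prop))
  calc _ = ∫⁻ x in Set.Ioi 0, ∫⁻ y in Set.Ioi 0, ∫⁻ w, cutoffKernel z q x y w
          ∂expMeasureCube :=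
        setLIntegral_congr_fun measurableSet_Ioi fun x hx =>
          setLIntegral_congr_fun measurableSet_Ioi fun y hy =>
            (lintegral_cutoffKernel_expMeasureCube hz hq hx hy).symm
    _ = ∫⁻ w, (∫⁻ x in Set.Ioi 0, ∫⁻ y in Set.Ioi 0, cutoffKernel z q x y w)
          ∂expMeasureCube := by
        simp only [hswap]
        exact lintegral_lintegral_swap hmeas.aemeasurable
    _ = _ := by
        refine lintegral_congr_ae ?_
        filter_upwards [ae_expMeasureCube_pos] with w hw
        exact lintegral_lintegral_cutoffKernel hz hq hw.1 hw.2.1 hw.2.2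

lemma integral_mirror_eq {z q : ℝ} (hz : 0 < z) (hq : 0 < q) :
    ∫ x in Set.Ioi (0 : ℝ), ∫ y in Set.Ioi (0 : ℝ),
        Real.exp (-(x + y + q / (x * y)) / z) / (x * y) =
      ∫ w, (max (Real.log (z ^ 3 / q) + sumLog w) 0) ^ 2 / 2 ∂expMeasureCube := by
  have hm := measurable_sumLog
  have hmax := integrable_max_add_sumLog_sq (Real.log (z ^ 3 / q))
  have hfin := hmax.lintegral_lt_top
  rw [← lintegral_mirror_eq_s11 hz hq] at hfin
  have hmeas : Measurable fun x : ℝ => ∫⁻ y in Set.Ioi 0,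
      ENNReal.ofReal (Real.exp (-(x + y + q / (x * y)) / z) / (x * y)) :=
    Measurable.lintegral_prod_right' (f := fun p : ℝ × ℝ =>
      ENNReal.ofReal (Real.exp (-(p.1 + p.2 + q / (p.1 * p.2)) / z) / (p.1 * p.2))) (by fun_prop)
  rw [integral_eq_lintegral_of_nonneg_ae (f := fun w => max _ _ ^ 2 / 2)
    (Filter.Eventually.of_forall fun w => by positivity)
    (by fun_prop), ← lintegral_mirror_eq_s11 hz hq,
    ← integral_toReal hmeas.aemeasurable (ae_lt_top hmeas hfin.ne)]
  refine setIntegral_congr_fun measurableSet_Ioi fun x hx => ?_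
  refine integral_eq_lintegral_of_nonneg_ae ?_ (Measurable.aestronglyMeasurable (by fun_prop))
  filter_upwards [ae_restrict_mem measurableSet_Ioi] with y hy
  have hx : 0 < x := hx
  have hy : 0 < y := hy
  simp only [Pi.zero_apply]
  positivity

/-- the mirror-symmetric Gamma asymptotics for `ℙ²`: for `z > 0`,
`lim_{q→0⁺} ( ∫_{(0,∞)²} e^{−(x+y+q/(xy))/z} dx dy/(xy)
  − ((log(z³/q) − 3γ)²/2 + π²/4) ) = 0`,
where `γ` is the Euler–Mascheroni constant. -/
theorem mirrorOscIntegral_P2_gamma_asymptotics (z : ℝ) (hz : 0 < z) :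
    Filter.Tendsto
      (fun q : ℝ =>
        (∫ x in Set.Ioi (0 : ℝ), ∫ y in Set.Ioi (0 : ℝ),
            Real.exp (-(x + y + q / (x * y)) / z) / (x * y)) -
          ((Real.log (z ^ 3 / q) - 3 * Real.eulerMascheroniConstant) ^ 2 / 2 +
            Real.pi ^ 2 / 4))
      (nhdsWithin 0 (Set.Ioi (0 : ℝ))) (nhds 0) := by
  have hlog : Filter.Tendsto (fun q : ℝ => Real.log (z ^ 3 / q))
      (nhdsWithin 0 (Set.Ioi (0 : ℝ))) Filter.atTop :=
    Real.tendsto_log_atTop.comp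
      (tendsto_inv_nhdsGT_zero.const_mul_atTop (show 0 < z ^ 3 by positivity))
  refine (tendsto_integral_max_sub.comp hlog).congr' ?_
  filter_upwards [self_mem_nhdsWithin] with q hq
  rw [integral_mirror_eq hz hq, Function.comp_apply]
end
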